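/- arXiv:1712.10045 — 5 statements merged into one kernel-verified Lean document; each statement's English description precedes it below -/
import Mathlib

section
/- There exists a constant C > 0 such that for every real R ≥ 1, every smooth function u : ℝ³ → ℝ, and every x with |x| ≥ R, one has |u(x)| ≤ C (1 + |x|)^{-1} Σ_{|I| + |J| ≤ 2} ‖∂^I Ω^J u‖_{L²({y ∈ ℝ³ : |y| ≥ R})}. In particular this applies to the regions D^{tr}(s) = {|x| ≥ −1 + s²/2} and D^{ex}(s) = {|x| ≥ s²/2} for every s ≥ 2, with a constant independent of s. -/
noncomputable section
open MeasureTheory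
open scoped ENNReal NNReal

/-- Euclidean 3-space. -/
abbrev E3 := EuclideanSpace ℝ (Fin 3)

/-- Partial derivative in the `i`-th coordinate direction on `ℝ³`. -/
def pd3 (i : Fin 3) (u : E3 → ℝ) : E3 → ℝ :=
  fun x => fderiv ℝ u x (EuclideanSpace.single i 1)

/-- The rotation vector field `Ω_{ab} = xᵃ∂_b − xᵇ∂_a` on `ℝ³`. -/
def rot3 (q : Fin 3 × Fin 3) (u : E3 → ℝ) : E3 → ℝ :=
  fun x => x q.1 * pd3 q.2 u x - x q.2 * pd3 q.1 u x

open Set Real in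
lemma lintegral_E3_eq (F : E3 → ℝ≥0∞) (hF : Measurable F) :
    ∫⁻ y, F y = ∫⁻ z : ℝ, ∫⁻ q : ℝ × ℝ, F !₂[z, q.1, q.2] := by
  have h1 := (EuclideanSpace.volume_preserving_symm_measurableEquiv_toLp (Fin 3)).symm
  have h2 := (volume_preserving_piFinSuccAbove (fun _ : Fin 3 => ℝ) 0).symm
  have h3 := (MeasurePreserving.id (volume : Measure ℝ)).prod
    (volume_preserving_finTwoArrow ℝ).symm
  have h := h1.comp (h2.comp h3)
  rw [← h.lintegral_comp hF]
  erw [lintegral_prod]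
  · refine lintegral_congr fun z => lintegral_congr fun q => ?_
    simp only [Function.comp]
    congr 1
    ext i
    fin_cases i <;> rfl
  · exact (hF.comp h.measurable).aemeasurable

open Set Real in
lemma lintegral_eq_polar (F : ℝ × ℝ → ℝ≥0∞) (hF : Measurable F) :
    ∫⁻ p, F p = ∫⁻ r in Ioi (0 : ℝ), ∫⁻ t in Ioo (-π) π,
      ENNReal.ofReal r * F (r * cos t, r * sin t) := by
  rw [← lintegral_comp_polarCoord_symm, polarCoord_target, Measure.volume_eq_prod,
    setLIntegral_prod]
  · simp only [polarCoord_symm_apply, smul_eq_mul]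
  · simp only [polarCoord_symm_apply, smul_eq_mul]
    fun_prop

open Set Real in
lemma lintegral_spherical_le (F : E3 → ℝ≥0∞) (hF : Measurable F) :
    ∫⁻ φ in Ioo (-π) π, ∫⁻ ρ in Ioi (0 : ℝ), ∫⁻ α in Ioo 0 π,
      ENNReal.ofReal ρ * (ENNReal.ofReal (ρ * sin α) *
        F !₂[ρ * cos α, ρ * sin α * cos φ, ρ * sin α * sin φ]) ≤ ∫⁻ y, F y := by
  have hm : Measurable fun p : ℝ × ℝ × ℝ => F !₂[p.1, p.2.1, p.2.2] := by
    refine hF.comp (Continuous.measurable ?_)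
    refine (PiLp.continuous_toLp 2 _).comp ?_
    refine continuous_pi fun i => ?_
    fin_cases i <;> simp <;> fun_prop
  have hm' : ∀ {X : Type} [MeasurableSpace X] {f g h : X → ℝ}, Measurable f → Measurable g →
      Measurable h → Measurable fun x => F !₂[f x, g x, h x] := by
    intro X _ f g h hf hg hh
    exact hm.comp (hf.prodMk (hg.prodMk hh))
  calc _ ≤ ∫⁻ φ in Ioo (-π) π, ∫⁻ p : ℝ × ℝ, ENNReal.ofReal p.2 *
        F !₂[p.1, p.2 * cos φ, p.2 * sin φ] := by
        refine lintegral_mono fun φ => ?_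
        dsimp only
        rw [lintegral_eq_polar]
        · refine lintegral_mono fun ρ => lintegral_mono_set ?_
          exact Ioo_subset_Ioo_left (by linarith [pi_pos])
        · refine Measurable.mul (by fun_prop) (hm' ?_ ?_ ?_) <;> fun_prop
    _ = ∫⁻ φ in Ioo (-π) π, ∫⁻ z : ℝ, ∫⁻ b in Ioi (0 : ℝ), ENNReal.ofReal b *
        F !₂[z, b * cos φ, b * sin φ] := by
        refine lintegral_congr fun φ => ?_
        rw [Measure.volume_eq_prod, lintegral_prod]
        · refine lintegral_congr fun z => ?_
          rw [← lintegral_indicator measurableSet_Ioi]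
          refine lintegral_congr fun b => ?_
          by_cases hb : 0 < b
          · simp [hb]
          · simp [hb, ENNReal.ofReal_of_nonpos (not_lt.1 hb)]
        · refine (Measurable.mul (by fun_prop) (hm' ?_ ?_ ?_)).aemeasurable <;> fun_prop
    _ = ∫⁻ z : ℝ, ∫⁻ φ in Ioo (-π) π, ∫⁻ b in Ioi (0 : ℝ), ENNReal.ofReal b *
        F !₂[z, b * cos φ, b * sin φ] := by
        rw [lintegral_lintegral_swap]
        refine (Measurable.lintegral_prod_right'
          (f := fun w : (ℝ × ℝ) × ℝ => ENNReal.ofReal w.2 *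
            F !₂[w.1.2, w.2 * cos w.1.1, w.2 * sin w.1.1]) ?_).aemeasurable
        refine (Measurable.mul (by fun_prop) (hm' ?_ ?_ ?_)) <;> fun_prop
    _ = ∫⁻ z : ℝ, ∫⁻ b in Ioi (0 : ℝ), ∫⁻ φ in Ioo (-π) π, ENNReal.ofReal b *
        F !₂[z, b * cos φ, b * sin φ] := by
        refine lintegral_congr fun z => ?_
        rw [lintegral_lintegral_swap]
        refine (Measurable.mul (by fun_prop) (hm' ?_ ?_ ?_)).aemeasurable <;> fun_prop
    _ = ∫⁻ y, F y := by
        rw [lintegral_E3_eq F hF]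
        refine lintegral_congr fun z => ?_
        rw [lintegral_eq_polar]
        exact hm' (by fun_prop) (by fun_prop) (by fun_prop)

open Set Real in
lemma lintegral_scale_le (s : ℝ) (hs : 0 < s) (hs1 : s ≤ 1) (G : ℝ → ℝ≥0∞) :
    ∫⁻ t in Ioo (0 : ℝ) 1, ENNReal.ofReal s * G (s * t) ≤ ∫⁻ a in Ioo 0 π, G a := by
  have h := lintegral_image_eq_lintegral_abs_deriv_mul (s := Ioo (0 : ℝ) 1)
    (f := fun t => s * t) (f' := fun _ => s) measurableSet_Ioo
    (fun x _ => by simpa using ((hasDerivAt_id x).const_mul s).hasDerivWithinAt)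
    (fun a _ b _ hab => mul_left_cancel₀ hs.ne' hab) G
  simp only [abs_of_pos hs] at h
  rw [← h]
  refine lintegral_mono_set ?_
  rintro _ ⟨t, ⟨h0, h1⟩, rfl⟩
  exact ⟨by positivity, by nlinarith [pi_gt_three]⟩

/-- The point with spherical coordinates `(ρ, α, φ)`; the polar axis is the first one. -/
def sphPt (ρ α φ : ℝ) : E3 :=
  !₂[ρ * Real.cos α, ρ * Real.sin α * Real.cos φ, ρ * Real.sin α * Real.sin φ]

lemma continuous_sphPt {X : Type*} [TopologicalSpace X] {f g h : X → ℝ} (hf : Continuous f)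
    (hg : Continuous g) (hh : Continuous h) : Continuous fun x => sphPt (f x) (g x) (h x) := by
  refine (PiLp.continuous_toLp 2 _).comp ?_
  refine continuous_pi fun i => ?_
  fin_cases i <;> simp <;> fun_prop

lemma norm_sphPt (ρ α φ : ℝ) (hρ : 0 ≤ ρ) : ‖sphPt ρ α φ‖ = ρ := by
  rw [EuclideanSpace.norm_eq, sphPt, Real.sqrt_eq_iff_eq_sq (by positivity) hρ]
  simp only [Fin.sum_univ_three, Real.norm_eq_abs, sq_abs]
  simp
  linear_combination ρ ^ 2 * (Real.sin α ^ 2) * (Real.sin_sq_add_cos_sq φ) +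
    ρ ^ 2 * Real.sin_sq_add_cos_sq α

open Set Real in
lemma lintegral_cone_le (L : E3 ≃ₗᵢ[ℝ] E3) (F : E3 → ℝ≥0∞) (hF : Measurable F) (r : ℝ)
    (hr : 0 < r) :
    ∫⁻ φ in Ioo (0 : ℝ) 1, ∫⁻ s in Ioo (0 : ℝ) 1, ∫⁻ t in Ioo (0 : ℝ) 1,
      ENNReal.ofReal (r ^ 2 / 2 * (s ^ 2 * t)) * F (L (sphPt (r + s) (s * t) φ)) ≤
      ∫⁻ y in {y | r ≤ ‖y‖}, F y := by
  have hS : MeasurableSet {y : E3 | r ≤ ‖y‖} := measurableSet_le measurable_const measurable_norm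
  set F' := ({y : E3 | r ≤ ‖y‖}).indicator F with hF'
  have hFm : Measurable F' := hF.indicator hS
  rw [← lintegral_indicator hS, ← (L.measurePreserving).lintegral_comp hFm]
  refine le_trans ?_ (lintegral_spherical_le _ (hFm.comp L.continuous.measurable))
  refine (lintegral_mono_set (t := Ioo (-π) π)
    (Ioo_subset_Ioo (by linarith [pi_pos]) (by linarith [pi_gt_three]))).trans ?_
  refine lintegral_mono fun φ => ?_
  dsimp only
  have hshift : ∫⁻ s in Ioo (0 : ℝ) 1, ∫⁻ α in Ioo 0 π,
      ENNReal.ofReal (r + s) *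
        (ENNReal.ofReal ((r + s) * sin α) * F' (L (sphPt (r + s) α φ))) ≤
      ∫⁻ ρ in Ioi (0 : ℝ), ∫⁻ α in Ioo 0 π,
      ENNReal.ofReal ρ * (ENNReal.ofReal (ρ * sin α) * F' (L (sphPt ρ α φ))) := by
    rw [← lintegral_indicator measurableSet_Ioi, ← lintegral_indicator measurableSet_Ioo,
      ← lintegral_add_left_eq_self (μ := (volume : Measure ℝ)) ((Ioi (0 : ℝ)).indicator _) r]
    refine lintegral_mono fun s => ?_
    by_cases h : s ∈ Ioo (0 : ℝ) 1
    · have : r + s ∈ Ioi (0 : ℝ) := add_pos hr h.1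
      rw [indicator_of_mem h, indicator_of_mem this]
    · rw [indicator_of_notMem h]
      exact zero_le
  refine le_trans ?_ hshift
  refine setLIntegral_mono' measurableSet_Ioo fun s hs => ?_
  refine le_trans ?_ (lintegral_scale_le s hs.1 hs.2.le _)
  refine setLIntegral_mono' measurableSet_Ioo fun t ht => ?_
  have hmem : L (sphPt (r + s) (s * t) φ) ∈ {y : E3 | r ≤ ‖y‖} := by
    rw [mem_ofPred_eq, L.norm_map, norm_sphPt _ _ _ (by linarith [hs.1])]; linarith [hs.1]
  have hrs : 0 ≤ r + s := by linarith [hs.1]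
  rw [hF', indicator_of_mem hmem, ← mul_assoc (ENNReal.ofReal (r + s)), ← mul_assoc (ENNReal.ofReal s),
    ← ENNReal.ofReal_mul hrs, ← ENNReal.ofReal_mul hs.1.le]
  refine mul_le_mul' (ENNReal.ofReal_le_ofReal ?_) le_rfl
  have h0 : 0 < s * t := mul_pos hs.1 ht.1
  have h1 : s * t ≤ 1 := by nlinarith [hs.1, hs.2, ht.1, ht.2]
  have h2 : s * t / 2 ≤ sin (s * t) := by
    refine le_trans ?_ (mul_le_sin h0.le (by linarith [pi_gt_three]))
    have : 1 / 2 ≤ 2 / π := by rw [div_le_div_iff₀ (by norm_num) pi_pos]; linarith [pi_le_four]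
    nlinarith
  have h3 : r ^ 2 ≤ (r + s) ^ 2 := by have := hs.1; gcongr; linarith
  calc r ^ 2 / 2 * (s ^ 2 * t) = s * (r ^ 2 * (s * t / 2)) := by ring
    _ ≤ s * ((r + s) ^ 2 * sin (s * t)) := by have := hs.1; gcongr
    _ = _ := by ring

lemma contDiff_pd3 {u : E3 → ℝ} (hu : ContDiff ℝ (⊤ : ℕ∞) u) (i : Fin 3) :
    ContDiff ℝ (⊤ : ℕ∞) (pd3 i u) :=
  (hu.fderiv_right (m := (⊤ : ℕ∞)) (by simp)).clm_apply contDiff_const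

lemma contDiff_coord (i : Fin 3) : ContDiff ℝ (⊤ : ℕ∞) fun x : E3 => x i :=
  (EuclideanSpace.proj (𝕜 := ℝ) i).contDiff

lemma contDiff_rot3 {u : E3 → ℝ} (hu : ContDiff ℝ (⊤ : ℕ∞) u) (q : Fin 3 × Fin 3) :
    ContDiff ℝ (⊤ : ℕ∞) (rot3 q u) :=
  ((contDiff_coord q.1).mul (contDiff_pd3 hu q.2)).sub
    ((contDiff_coord q.2).mul (contDiff_pd3 hu q.1))

lemma fderiv_apply_eq_sum_pd3 (f : E3 → ℝ) (x w : E3) :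
    fderiv ℝ f x w = ∑ i, w i * pd3 i f x := by
  conv_lhs => rw [← (EuclideanSpace.basisFun (Fin 3) ℝ).sum_repr w]
  simp [pd3]

lemma pd3_coord_mul {g : E3 → ℝ} (hg : ContDiff ℝ (⊤ : ℕ∞) g) (i a : Fin 3) (x : E3) :
    pd3 i (fun y => y a * g y) x = (if a = i then 1 else 0) * g x + x a * pd3 i g x := by
  have h1 : HasFDerivAt (fun y : E3 => y a) (EuclideanSpace.proj (𝕜 := ℝ) a) x :=
    (EuclideanSpace.proj (𝕜 := ℝ) a).hasFDerivAt
  have h2 := (hg.differentiable (by simp) x).hasFDerivAt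
  rw [pd3, (h1.fun_mul h2).fderiv]
  simp [pd3]
  ring

lemma pd3_comm {u : E3 → ℝ} (hu : ContDiff ℝ (⊤ : ℕ∞) u) (i j : Fin 3) (x : E3) :
    pd3 i (pd3 j u) x = pd3 j (pd3 i u) x := by
  have hs : IsSymmSndFDerivAt ℝ u x :=
    hu.contDiffAt.isSymmSndFDerivAt (by
      simpa using WithTop.coe_le_coe.2 (le_top (a := (2 : ℕ∞))))
  have hd : DifferentiableAt ℝ (fderiv ℝ u) x :=
    (hu.fderiv_right (m := (⊤ : ℕ∞)) (by simp)).differentiable (by simp) x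
  have key : ∀ k l : Fin 3, pd3 k (pd3 l u) x =
      fderiv ℝ (fderiv ℝ u) x (EuclideanSpace.single k 1) (EuclideanSpace.single l 1) := by
    intro k l
    rw [pd3]
    have : pd3 l u = fun y => fderiv ℝ u y (EuclideanSpace.single l 1) := rfl
    rw [this, fderiv_clm_apply hd (differentiableAt_const _)]
    simp
  rw [key, key, hs.eq]

lemma rot3_pd3_eq {u : E3 → ℝ} (hu : ContDiff ℝ (⊤ : ℕ∞) u) (q : Fin 3 × Fin 3) (i : Fin 3)
    (x : E3) : rot3 q (pd3 i u) x = pd3 i (rot3 q u) x -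
      ((if q.1 = i then 1 else 0) * pd3 q.2 u x - (if q.2 = i then 1 else 0) * pd3 q.1 u x) := by
  have h : pd3 i (rot3 q u) x = pd3 i (fun y => y q.1 * pd3 q.2 u y) x -
      pd3 i (fun y => y q.2 * pd3 q.1 u y) x := by
    have d : ∀ a b : Fin 3, DifferentiableAt ℝ (fun y => y a * pd3 b u y) x := fun a b =>
      ((contDiff_coord a).mul (contDiff_pd3 hu b)).differentiable (by simp) x
    have := fderiv_fun_sub (d q.1 q.2) (d q.2 q.1)
    show fderiv ℝ (rot3 q u) x (EuclideanSpace.single i 1) = _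
    have e : rot3 q u = fun y => y q.1 * pd3 q.2 u y - y q.2 * pd3 q.1 u y := rfl
    rw [e, this]
    rfl
  rw [h, pd3_coord_mul (contDiff_pd3 hu _), pd3_coord_mul (contDiff_pd3 hu _), rot3,
    pd3_comm hu q.2, pd3_comm hu q.1]
  ring

/-- The sum of the absolute values of all translations and rotations of `f`. -/
def firstOrderSum (f : E3 → ℝ) (y : E3) : ℝ := ∑ i, |pd3 i f y| + ∑ q, |rot3 q f y|

/-- The sum of the absolute values of all derivatives `∂^I Ω^J u` with `|I| + |J| ≤ 2`. -/
def derivSum (u : E3 → ℝ) (y : E3) : ℝ :=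
  |u y| + ∑ a, |pd3 a u y| + ∑ q, |rot3 q u y| + ∑ a, ∑ b, |pd3 a (pd3 b u) y|
    + ∑ a, ∑ q, |pd3 a (rot3 q u) y| + ∑ q, ∑ q', |rot3 q (rot3 q' u) y|

lemma continuous_derivSum {u : E3 → ℝ} (hu : ContDiff ℝ (⊤ : ℕ∞) u) :
    Continuous (derivSum u) := by
  have h0 := hu.continuous
  have h1 := fun i => (contDiff_pd3 hu i).continuous
  have h2 := fun q => (contDiff_rot3 hu q).continuous
  have h3 := fun i j => (contDiff_pd3 (contDiff_pd3 hu i) j).continuous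
  have h4 := fun q j => (contDiff_pd3 (contDiff_rot3 hu q) j).continuous
  have h5 := fun q q' => (contDiff_rot3 (contDiff_rot3 hu q) q').continuous
  unfold derivSum
  fun_prop

/-- The point at angle `α` of the great circle spanned by `a` and `b`. -/
def circ (a b : E3) (α : ℝ) : E3 := Real.cos α • a + Real.sin α • b

/-- The derivative of `f` along the spiral `s ↦ (r + s) • circ a b (s * θ)`, expressed through
translations and rotations. -/
def spiralDeriv (r θ : ℝ) (a b : E3) (f : E3 → ℝ) (s : ℝ) : ℝ :=
  ∑ i, circ a b (s * θ) i * pd3 i f ((r + s) • circ a b (s * θ)) +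
    ∑ q : Fin 3 × Fin 3, θ * (a q.1 * b q.2) * rot3 q f ((r + s) • circ a b (s * θ))

lemma hasDerivAt_circ (a b : E3) (θ s : ℝ) :
    HasDerivAt (fun s => circ a b (s * θ)) (θ • circ b (-a) (s * θ)) s := by
  have h : HasDerivAt (fun s : ℝ => s * θ) θ s := by simpa using (hasDerivAt_id s).mul_const θ
  have := (h.cos.smul_const a).add (h.sin.smul_const b)
  refine this.congr_deriv ?_
  simp only [circ]
  module

lemma hasDerivAt_comp_spiral {f : E3 → ℝ} (hf : ContDiff ℝ (⊤ : ℕ∞) f) {a b : E3}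
    (ha : ‖a‖ = 1) (hb : ‖b‖ = 1) (hab : inner ℝ a b = 0) (r θ s : ℝ) :
    HasDerivAt (fun s => f ((r + s) • circ a b (s * θ))) (spiralDeriv r θ a b f s) s := by
  have hY : HasDerivAt (fun s => (r + s) • circ a b (s * θ))
      ((r + s) • θ • circ b (-a) (s * θ) + (1 : ℝ) • circ a b (s * θ)) s :=
    ((hasDerivAt_id s).const_add r).fun_smul (hasDerivAt_circ a b θ s)
  have := (hf.differentiable (by simp) _).hasFDerivAt.comp_hasDerivAt s hY
  refine this.congr_deriv ?_
  rw [fderiv_apply_eq_sum_pd3, spiralDeriv, Fintype.sum_prod_type]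
  have h1 : a 0 ^ 2 + a 1 ^ 2 + a 2 ^ 2 = 1 := by
    have := EuclideanSpace.real_norm_sq_eq a
    rw [ha, Fin.sum_univ_three] at this; linarith
  have h2 : b 0 ^ 2 + b 1 ^ 2 + b 2 ^ 2 = 1 := by
    have := EuclideanSpace.real_norm_sq_eq b
    rw [hb, Fin.sum_univ_three] at this; linarith
  have h3 : a 0 * b 0 + a 1 * b 1 + a 2 * b 2 = 0 := by
    rw [PiLp.inner_apply, Fin.sum_univ_three] at hab
    simp at hab; linarith
  simp only [Fin.sum_univ_three, rot3]
  generalize hy : (r + s) • circ a b (s * θ) = y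
  have hyi : ∀ i, y i = (r + s) * (Real.cos (s * θ) * a i + Real.sin (s * θ) * b i) := by
    intro i; rw [← hy]; simp [circ, mul_add]
  simp only [hyi]
  simp only [circ, PiLp.add_apply, PiLp.smul_apply, PiLp.neg_apply, smul_eq_mul]
  generalize Real.cos (s * θ) = C
  generalize Real.sin (s * θ) = S
  generalize pd3 0 f y = p0
  generalize pd3 1 f y = p1
  generalize pd3 2 f y = p2
  linear_combination -θ * (r + s) * C * (b 0 * p0 + b 1 * p1 + b 2 * p2) * h1
    + θ * (r + s) * S * (a 0 * p0 + a 1 * p1 + a 2 * p2) * h2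
    - θ * (r + s) * (S * (b 0 * p0 + b 1 * p1 + b 2 * p2)
      - C * (a 0 * p0 + a 1 * p1 + a 2 * p2)) * h3

lemma norm_circ {a b : E3} (ha : ‖a‖ = 1) (hb : ‖b‖ = 1) (hab : inner ℝ a b = 0) (α : ℝ) :
    ‖circ a b α‖ = 1 := by
  have h : ‖circ a b α‖ ^ 2 = 1 := by
    rw [circ, norm_add_sq_real, norm_smul, norm_smul, inner_smul_left, inner_smul_right, hab,
      ha, hb]
    simp
  exact (pow_eq_one_iff_of_nonneg (norm_nonneg _) two_ne_zero).1 h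

lemma abs_coord_le_one {w : E3} (hw : ‖w‖ = 1) (i : Fin 3) : |w i| ≤ 1 := by
  simpa [hw] using PiLp.norm_apply_le w i

lemma abs_spiralDeriv_le (f : E3 → ℝ) {a b : E3} (ha : ‖a‖ = 1) (hb : ‖b‖ = 1)
    (hab : inner ℝ a b = 0) (r s : ℝ) {θ : ℝ} (hθ : |θ| ≤ 1) :
    |spiralDeriv r θ a b f s| ≤ firstOrderSum f ((r + s) • circ a b (s * θ)) := by
  refine (abs_add_le _ _).trans (add_le_add ?_ ?_)
  · refine (Finset.abs_sum_le_sum_abs _ _).trans (Finset.sum_le_sum fun i _ => ?_)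
    rw [abs_mul]
    exact mul_le_of_le_one_left (abs_nonneg _) (abs_coord_le_one (norm_circ ha hb hab _) i)
  · refine (Finset.abs_sum_le_sum_abs _ _).trans (Finset.sum_le_sum fun q _ => ?_)
    rw [abs_mul, abs_mul, abs_mul]
    refine mul_le_of_le_one_left (abs_nonneg _) ?_
    have h1 := abs_coord_le_one ha q.1
    have h2 := abs_coord_le_one hb q.2
    exact mul_le_one₀ hθ (by positivity) (mul_le_one₀ h1 (abs_nonneg _) h2)

/-- The second derivative of `u` along the spiral `s ↦ (r + s) • circ a b (s * θ)`. -/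
def spiralDeriv₂ (r θ : ℝ) (a b : E3) (u : E3 → ℝ) (s : ℝ) : ℝ :=
  ∑ i, ((θ • circ b (-a) (s * θ)) i * pd3 i u ((r + s) • circ a b (s * θ)) +
      circ a b (s * θ) i * spiralDeriv r θ a b (pd3 i u) s) +
    ∑ q : Fin 3 × Fin 3, θ * (a q.1 * b q.2) * spiralDeriv r θ a b (rot3 q u) s

lemma hasDerivAt_spiralDeriv {u : E3 → ℝ} (hu : ContDiff ℝ (⊤ : ℕ∞) u) {a b : E3}
    (ha : ‖a‖ = 1) (hb : ‖b‖ = 1) (hab : inner ℝ a b = 0) (r θ s : ℝ) :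
    HasDerivAt (spiralDeriv r θ a b u) (spiralDeriv₂ r θ a b u s) s := by
  refine HasDerivAt.add (HasDerivAt.fun_sum fun i _ => ?_) (HasDerivAt.fun_sum fun q _ => ?_)
  · refine HasDerivAt.fun_mul ?_ (hasDerivAt_comp_spiral (contDiff_pd3 hu i) ha hb hab r θ s)
    exact (EuclideanSpace.proj (𝕜 := ℝ) i).hasFDerivAt.comp_hasDerivAt s (hasDerivAt_circ a b θ s)
  · exact (hasDerivAt_comp_spiral (contDiff_rot3 hu q) ha hb hab r θ s).const_mul _

lemma continuous_spiralDeriv {u : E3 → ℝ} (hu : ContDiff ℝ (⊤ : ℕ∞) u) {a b : E3}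
    (ha : ‖a‖ = 1) (hb : ‖b‖ = 1) (hab : inner ℝ a b = 0) (r θ : ℝ) :
    Continuous (spiralDeriv r θ a b u) :=
  continuous_iff_continuousAt.2 fun s => (hasDerivAt_spiralDeriv hu ha hb hab r θ s).continuousAt

lemma continuous_circ (a b : E3) (θ : ℝ) : Continuous fun s => circ a b (s * θ) :=
  continuous_iff_continuousAt.2 fun s => (hasDerivAt_circ a b θ s).continuousAt

lemma continuous_spiralDeriv₂ {u : E3 → ℝ} (hu : ContDiff ℝ (⊤ : ℕ∞) u) {a b : E3}
    (ha : ‖a‖ = 1) (hb : ‖b‖ = 1) (hab : inner ℝ a b = 0) (r θ : ℝ) :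
    Continuous (spiralDeriv₂ r θ a b u) := by
  have h1 := fun i => continuous_spiralDeriv (contDiff_pd3 hu i) ha hb hab r θ
  have h2 := fun q => continuous_spiralDeriv (contDiff_rot3 hu q) ha hb hab r θ
  have h3 := fun i => (contDiff_pd3 hu i).continuous
  have h4 := continuous_circ a b θ
  have h5 := continuous_circ b (-a) θ
  unfold spiralDeriv₂
  fun_prop

lemma firstOrderSum_nonneg (f : E3 → ℝ) (y : E3) : 0 ≤ firstOrderSum f y := by
  unfold firstOrderSum; positivity

lemma abs_rot3_pd3_le {u : E3 → ℝ} (hu : ContDiff ℝ (⊤ : ℕ∞) u) (q : Fin 3 × Fin 3) (i : Fin 3)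
    (y : E3) : |rot3 q (pd3 i u) y| ≤ |pd3 i (rot3 q u) y| + 2 * ∑ j, |pd3 j u y| := by
  have hj : ∀ (P : Prop) [Decidable P] (j : Fin 3),
      |(if P then 1 else 0) * pd3 j u y| ≤ ∑ j, |pd3 j u y| := by
    intro P _ j
    have h := Finset.single_le_sum (f := fun j => |pd3 j u y|) (fun j _ => abs_nonneg _)
      (Finset.mem_univ j)
    refine le_trans ?_ h
    split_ifs <;> simp
  rw [rot3_pd3_eq hu]
  refine (abs_sub _ _).trans (add_le_add le_rfl ((abs_sub _ _).trans ?_))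
  linarith [hj (q.1 = i) q.2, hj (q.2 = i) q.1]

lemma derivSum_bound {u : E3 → ℝ} (hu : ContDiff ℝ (⊤ : ℕ∞) u) (y : E3) :
    ∑ i, |pd3 i u y| + ∑ i, firstOrderSum (pd3 i u) y + ∑ q, firstOrderSum (rot3 q u) y ≤
      55 * derivSum u y := by
  have h1 : ∑ i, ∑ q, |rot3 q (pd3 i u) y| ≤
      ∑ i, ∑ q, |pd3 i (rot3 q u) y| + 54 * ∑ j, |pd3 j u y| := by
    calc _ ≤ ∑ i, ∑ q, (|pd3 i (rot3 q u) y| + 2 * ∑ j, |pd3 j u y|) :=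
          Finset.sum_le_sum fun i _ => Finset.sum_le_sum fun q _ => abs_rot3_pd3_le hu q i y
      _ = _ := by
          simp only [Finset.sum_add_distrib, Finset.sum_const, Finset.card_univ, Fintype.card_prod,
            Fintype.card_fin, nsmul_eq_mul]
          push_cast; ring
  simp only [firstOrderSum, Finset.sum_add_distrib, derivSum]
  rw [Finset.sum_comm (f := fun q i => |pd3 i (rot3 q u) y|),
    Finset.sum_comm (f := fun i j => |pd3 j (pd3 i u) y|),
    Finset.sum_comm (f := fun i j => |rot3 j (rot3 i u) y|)]
  have a0 : 0 ≤ |u y| := abs_nonneg _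
  have a1 : 0 ≤ ∑ a, |pd3 a u y| := by positivity
  have a2 : 0 ≤ ∑ q, |rot3 q u y| := by positivity
  have a3 : 0 ≤ ∑ a, ∑ b, |pd3 a (pd3 b u) y| := by positivity
  have a4 : 0 ≤ ∑ a, ∑ q, |pd3 a (rot3 q u) y| := by positivity
  have a5 : 0 ≤ ∑ q, ∑ q', |rot3 q (rot3 q' u) y| := by positivity
  linarith

lemma abs_spiralDeriv₂_le {u : E3 → ℝ} (hu : ContDiff ℝ (⊤ : ℕ∞) u) {a b : E3} (ha : ‖a‖ = 1)
    (hb : ‖b‖ = 1) (hab : inner ℝ a b = 0) (r s : ℝ) {θ : ℝ} (hθ : |θ| ≤ 1) :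
    |spiralDeriv₂ r θ a b u s| ≤ 55 * derivSum u ((r + s) • circ a b (s * θ)) := by
  refine le_trans ?_ (derivSum_bound hu _)
  rw [← Finset.sum_add_distrib]
  have hab' : inner ℝ b (-a) = 0 := by rw [inner_neg_right, real_inner_comm, hab, neg_zero]
  have hc := norm_circ hb (by rwa [norm_neg]) hab' (s * θ)
  refine (abs_add_le _ _).trans (add_le_add ?_ ?_)
  · refine (Finset.abs_sum_le_sum_abs _ _).trans (Finset.sum_le_sum fun i _ => ?_)
    refine (abs_add_le _ _).trans (add_le_add ?_ ?_)
    · rw [abs_mul, PiLp.smul_apply, smul_eq_mul, abs_mul]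
      exact mul_le_of_le_one_left (abs_nonneg _)
        (mul_le_one₀ hθ (abs_nonneg _) (abs_coord_le_one hc i))
    · rw [abs_mul]
      exact (mul_le_of_le_one_left (abs_nonneg _)
        (abs_coord_le_one (norm_circ ha hb hab _) i)).trans (abs_spiralDeriv_le _ ha hb hab r s hθ)
  · refine (Finset.abs_sum_le_sum_abs _ _).trans (Finset.sum_le_sum fun q _ => ?_)
    rw [abs_mul, abs_mul, abs_mul]
    refine (mul_le_of_le_one_left (abs_nonneg _) ?_).trans (abs_spiralDeriv_le _ ha hb hab r s hθ)
    have h1 := abs_coord_le_one ha q.1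
    have h2 := abs_coord_le_one hb q.2
    exact mul_le_one₀ hθ (by positivity) (mul_le_one₀ h1 (abs_nonneg _) h2)

lemma eq_integral_of_hasDerivAt {v v' v'' : ℝ → ℝ} (h : ∀ s, HasDerivAt v (v' s) s)
    (h' : ∀ s, HasDerivAt v' (v'' s) s) (hc : Continuous v'') :
    v 0 = ∫ s in (0 : ℝ)..1, s * (2 * v s - 4 * (1 - s) * v' s + (1 - s) ^ 2 * v'' s) := by
  have hv : Continuous v := continuous_iff_continuousAt.2 fun s => (h s).continuousAt
  have hv' : Continuous v' := continuous_iff_continuousAt.2 fun s => (h' s).continuousAt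
  have hd : ∀ s ∈ Set.uIcc (0 : ℝ) 1, HasDerivAt
      (fun s => s * ((1 - s) ^ 2 * v' s - 2 * (1 - s) * v s) - (1 - s) ^ 2 * v s)
      (s * (2 * v s - 4 * (1 - s) * v' s + (1 - s) ^ 2 * v'' s)) s := by
    intro s _
    have h1 : HasDerivAt (fun s : ℝ => 1 - s) (-1) s := by
      simpa using (hasDerivAt_id s).const_sub 1
    have h2 := h1.fun_pow 2
    refine (((hasDerivAt_id s).fun_mul ((h2.fun_mul (h' s)).fun_sub
      ((h1.const_mul 2).fun_mul (h s)))).fun_sub (h2.fun_mul (h s))).congr_deriv ?_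
    simp
    ring
  rw [intervalIntegral.integral_eq_sub_of_hasDerivAt hd
    (Continuous.intervalIntegrable (by fun_prop) _ _)]
  simp

lemma sq_le_integral_sq {c : ℝ} {h : ℝ → ℝ} (hh : Continuous h)
    (hc : c ≤ ∫ s in (0 : ℝ)..1, h s) (h0 : 0 ≤ c) : c ^ 2 ≤ ∫ s in (0 : ℝ)..1, h s ^ 2 := by
  have h1 : ∫ s in (0 : ℝ)..1, 2 * c * h s ≤ ∫ s in (0 : ℝ)..1, (c ^ 2 + h s ^ 2) :=
    intervalIntegral.integral_mono_on zero_le_one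
      (Continuous.intervalIntegrable (by fun_prop) _ _)
      (Continuous.intervalIntegrable (by fun_prop) _ _)
      (fun s _ => by nlinarith [sq_nonneg (c - h s)])
  rw [intervalIntegral.integral_const_mul, intervalIntegral.integral_add
    (Continuous.intervalIntegrable (by fun_prop) _ _)
    (Continuous.intervalIntegrable (by fun_prop) _ _)] at h1
  simp only [intervalIntegral.integral_const, sub_zero, one_smul] at h1
  nlinarith

lemma sq_le_integral_derivSum {u : E3 → ℝ} (hu : ContDiff ℝ (⊤ : ℕ∞) u) {a b : E3} (ha : ‖a‖ = 1)
    (hb : ‖b‖ = 1) (hab : inner ℝ a b = 0) (r : ℝ) {θ : ℝ} (hθ : |θ| ≤ 1) :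
    u (r • a) ^ 2 ≤
      ∫ s in (0 : ℝ)..1, (s * (61 * derivSum u ((r + s) • circ a b (s * θ)))) ^ 2 := by
  have hS := continuous_derivSum hu
  have hcirc := continuous_circ a b θ
  have h2c := continuous_spiralDeriv₂ hu ha hb hab r θ
  have h1c := continuous_spiralDeriv hu ha hb hab r θ
  have h0c := hu.continuous
  rw [← sq_abs]
  refine sq_le_integral_sq (by fun_prop) ?_ (abs_nonneg _)
  have h := eq_integral_of_hasDerivAt (hasDerivAt_comp_spiral hu ha hb hab r θ)
    (hasDerivAt_spiralDeriv hu ha hb hab r θ) h2c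
  have e : u (r • a) = u ((r + 0) • circ a b (0 * θ)) := by simp [circ]
  rw [e, h]
  refine (intervalIntegral.abs_integral_le_integral_abs zero_le_one).trans ?_
  refine intervalIntegral.integral_mono_on zero_le_one
      (Continuous.intervalIntegrable (by fun_prop) _ _)
      (Continuous.intervalIntegrable (by fun_prop) _ _) fun s hs => ?_
  rw [abs_mul, abs_of_nonneg hs.1]
  refine mul_le_mul_of_nonneg_left ?_ hs.1
  set y := (r + s) • circ a b (s * θ) with hy
  have b0 : |u y| + firstOrderSum u y ≤ derivSum u y := by
    have a3 : 0 ≤ ∑ a, ∑ b, |pd3 a (pd3 b u) y| := by positivity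
    have a4 : 0 ≤ ∑ a, ∑ q, |pd3 a (rot3 q u) y| := by positivity
    have a5 : 0 ≤ ∑ q, ∑ q', |rot3 q (rot3 q' u) y| := by positivity
    unfold derivSum firstOrderSum
    linarith
  have b1 := abs_spiralDeriv_le u ha hb hab r s hθ
  have b2 := abs_spiralDeriv₂_le hu ha hb hab r s hθ
  rw [← hy] at b1 b2
  have c1 : |4 * (1 - s) * spiralDeriv r θ a b u s| ≤ 4 * |spiralDeriv r θ a b u s| := by
    rw [abs_mul]
    refine mul_le_mul_of_nonneg_right ?_ (abs_nonneg _)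
    rw [abs_le]; constructor <;> linarith [hs.1, hs.2]
  have c2 : |(1 - s) ^ 2 * spiralDeriv₂ r θ a b u s| ≤ |spiralDeriv₂ r θ a b u s| := by
    rw [abs_mul]
    refine mul_le_of_le_one_left (abs_nonneg _) ?_
    rw [abs_le]; constructor <;> nlinarith [hs.1, hs.2]
  have c0 : |2 * u y| = 2 * |u y| := by rw [abs_mul]; simp
  have := abs_add_le (2 * u y - 4 * (1 - s) * spiralDeriv r θ a b u s)
    ((1 - s) ^ 2 * spiralDeriv₂ r θ a b u s)
  have := abs_sub (2 * u y) (4 * (1 - s) * spiralDeriv r θ a b u s)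
  have := firstOrderSum_nonneg u y
  have := abs_nonneg (u y)
  linarith

lemma exists_linearIsometryEquiv_single {a : E3} (ha : ‖a‖ = 1) :
    ∃ L : E3 ≃ₗᵢ[ℝ] E3, L (EuclideanSpace.single 0 1) = a := by
  obtain ⟨b, hb⟩ := Orthonormal.exists_orthonormalBasis_extension_of_card_eq (𝕜 := ℝ) (E := E3)
    (ι := Fin 3) (by simp) (v := fun _ => a) (s := {0}) (by
      refine ⟨fun i => by simpa using ha, fun i j hij => ?_⟩
      exact absurd (Subsingleton.elim i j) hij)
  exact ⟨b.repr.symm, by simpa using hb 0 rfl⟩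

lemma smul_circ_eq (L : E3 ≃ₗᵢ[ℝ] E3) (ρ α φ : ℝ) :
    ρ • circ (L (EuclideanSpace.single 0 1)) (L (sphPt 1 (Real.pi / 2) φ)) α =
      L (sphPt ρ α φ) := by
  rw [circ, ← map_smul, ← map_smul, ← map_add, ← map_smul]
  congr 1
  ext i
  fin_cases i <;> simp [sphPt, mul_assoc]

lemma inner_single_sphPt (φ : ℝ) :
    inner ℝ (EuclideanSpace.single (0 : Fin 3) (1 : ℝ)) (sphPt 1 (Real.pi / 2) φ) = 0 := by
  simp [PiLp.inner_apply, sphPt]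

lemma continuous_derivSum_sphPt {u : E3 → ℝ} (hu : ContDiff ℝ (⊤ : ℕ∞) u) (L : E3 ≃ₗᵢ[ℝ] E3)
    {X : Type*} [TopologicalSpace X] {f g h : X → ℝ} (hf : Continuous f) (hg : Continuous g)
    (hh : Continuous h) : Continuous fun x => derivSum u (L (sphPt (f x) (g x) (h x))) :=
  (continuous_derivSum hu).comp (L.continuous.comp (continuous_sphPt hf hg hh))

open Set in
lemma ofReal_sq_le_lintegral_curve {u : E3 → ℝ} (hu : ContDiff ℝ (⊤ : ℕ∞) u)
    (L : E3 ≃ₗᵢ[ℝ] E3) (r φ : ℝ) {t : ℝ} (ht : t ∈ Ioo (1 / 2 : ℝ) 1) :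
    ENNReal.ofReal (r ^ 2 * u (r • L (EuclideanSpace.single 0 1)) ^ 2 / 4) ≤
      ENNReal.ofReal 3721 * ∫⁻ s in Ioo (0 : ℝ) 1, ENNReal.ofReal (r ^ 2 / 2 * (s ^ 2 * t)) *
        ENNReal.ofReal (derivSum u (L (sphPt (r + s) (s * t) φ)) ^ 2) := by
  have h := sq_le_integral_derivSum hu (a := L (EuclideanSpace.single 0 1))
    (b := L (sphPt 1 (Real.pi / 2) φ)) (by simp)
    (by rw [L.norm_map, norm_sphPt _ _ _ zero_le_one])
    (by rw [L.inner_map_map]; exact inner_single_sphPt φ) r (θ := t)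
    (by rw [abs_le]; constructor <;> linarith [ht.1, ht.2])
  simp only [smul_circ_eq] at h
  have hcont : Continuous fun s => derivSum u (L (sphPt (r + s) (s * t) φ)) :=
    continuous_derivSum_sphPt hu L (by fun_prop) (by fun_prop) (by fun_prop)
  set D := fun s => derivSum u (L (sphPt (r + s) (s * t) φ)) with hD
  set c := u (r • L (EuclideanSpace.single 0 1))
  have h2 : r ^ 2 * c ^ 2 / 4 ≤
      ∫ s in Ioo (0 : ℝ) 1, 3721 * (r ^ 2 / 2 * (s ^ 2 * t) * D s ^ 2) := by
    rw [← integral_Ioc_eq_integral_Ioo, ← intervalIntegral.integral_of_le zero_le_one]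
    calc r ^ 2 * c ^ 2 / 4 ≤ r ^ 2 * t / 2 * c ^ 2 := by
          nlinarith [ht.1, mul_nonneg (sq_nonneg r) (sq_nonneg c)]
      _ ≤ r ^ 2 * t / 2 * _ := mul_le_mul_of_nonneg_left h (by have := ht.1; positivity)
      _ = _ := by
          rw [← intervalIntegral.integral_const_mul]
          congr 1
          ext s
          rw [hD]
          ring
  refine (ENNReal.ofReal_le_ofReal h2).trans ?_
  have ht0 : 0 ≤ t := by linarith [ht.1]
  rw [ofReal_integral_eq_lintegral_ofReal, ← lintegral_const_mul]
  · refine lintegral_mono fun s => ?_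
    rw [ENNReal.ofReal_mul (by norm_num), ENNReal.ofReal_mul (by positivity)]
  · exact Measurable.mul (by fun_prop) (ENNReal.measurable_ofReal.comp (hcont.pow 2).measurable)
  · exact (Continuous.integrableOn_Icc (by fun_prop)).mono_set Ioo_subset_Icc_self
  · exact Filter.Eventually.of_forall fun s => by dsimp only; positivity

open Set in
lemma ofReal_sq_le_lintegral_sheet {u : E3 → ℝ} (hu : ContDiff ℝ (⊤ : ℕ∞) u)
    (L : E3 ≃ₗᵢ[ℝ] E3) (r φ : ℝ) :
    ENNReal.ofReal (r ^ 2 * u (r • L (EuclideanSpace.single 0 1)) ^ 2 / 8) ≤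
      ENNReal.ofReal 3721 * ∫⁻ s in Ioo (0 : ℝ) 1, ∫⁻ t in Ioo (0 : ℝ) 1,
        ENNReal.ofReal (r ^ 2 / 2 * (s ^ 2 * t)) *
        ENNReal.ofReal (derivSum u (L (sphPt (r + s) (s * t) φ)) ^ 2) := by
  have hc2 : Continuous fun p : ℝ × ℝ => derivSum u (L (sphPt (r + p.1) (p.1 * p.2) φ)) :=
    continuous_derivSum_sphPt hu L (by fun_prop) (by fun_prop) (by fun_prop)
  have hm : Measurable (Function.uncurry fun s t : ℝ =>
      ENNReal.ofReal (r ^ 2 / 2 * (s ^ 2 * t)) *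
      ENNReal.ofReal (derivSum u (L (sphPt (r + s) (s * t) φ)) ^ 2)) :=
    Measurable.mul (by fun_prop) (ENNReal.measurable_ofReal.comp (hc2.pow 2).measurable)
  rw [lintegral_lintegral_swap hm.aemeasurable]
  set c := u (r • L (EuclideanSpace.single 0 1)) with hc
  have h0 : ENNReal.ofReal (r ^ 2 * c ^ 2 / 8) =
      ∫⁻ t in Ioo (1 / 2 : ℝ) 1, ENNReal.ofReal (r ^ 2 * c ^ 2 / 4) := by
    rw [setLIntegral_const, Real.volume_Ioo, ← ENNReal.ofReal_mul (by positivity)]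
    congr 1; ring
  rw [h0]
  refine (setLIntegral_mono' measurableSet_Ioo
    fun t ht => ofReal_sq_le_lintegral_curve hu L r φ ht).trans ?_
  rw [lintegral_const_mul' _ _ ENNReal.ofReal_ne_top]
  exact mul_le_mul' le_rfl (lintegral_mono_set (Ioo_subset_Ioo_left (by norm_num)))

open Set in
lemma ofReal_sq_le_lintegral {u : E3 → ℝ} (hu : ContDiff ℝ (⊤ : ℕ∞) u) {x : E3} (hx : 0 < ‖x‖) :
    ENNReal.ofReal (‖x‖ ^ 2 * u x ^ 2) ≤
      ENNReal.ofReal 40000 * ∫⁻ y in {y | ‖x‖ ≤ ‖y‖}, ENNReal.ofReal (derivSum u y ^ 2) := by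
  set r := ‖x‖ with hr
  obtain ⟨L, hL⟩ := exists_linearIsometryEquiv_single (a := r⁻¹ • x)
    (by rw [norm_smul, norm_inv, Real.norm_eq_abs, abs_of_pos hx]; exact inv_mul_cancel₀ hx.ne')
  have hS := continuous_derivSum hu
  have hcone := lintegral_cone_le L (fun y => ENNReal.ofReal (derivSum u y ^ 2))
    (ENNReal.measurable_ofReal.comp (hS.pow 2).measurable) r hx
  have hfin : ENNReal.ofReal (r ^ 2 * u x ^ 2 / 8) ≤ ENNReal.ofReal 3721 *
      ∫⁻ y in {y | r ≤ ‖y‖}, ENNReal.ofReal (derivSum u y ^ 2) := by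
    have h0 : ENNReal.ofReal (r ^ 2 * u x ^ 2 / 8) =
        ∫⁻ φ in Ioo (0 : ℝ) 1, ENNReal.ofReal (r ^ 2 * u x ^ 2 / 8) := by
      rw [setLIntegral_const, Real.volume_Ioo]; simp
    have hφ := fun φ => ofReal_sq_le_lintegral_sheet hu L r φ
    simp only [hL, smul_inv_smul₀ hx.ne'] at hφ
    rw [h0]
    refine le_trans (lintegral_mono hφ) ?_
    rw [lintegral_const_mul' _ _ ENNReal.ofReal_ne_top]
    exact mul_le_mul' le_rfl hcone
  calc ENNReal.ofReal (r ^ 2 * u x ^ 2)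
      = ENNReal.ofReal 8 * ENNReal.ofReal (r ^ 2 * u x ^ 2 / 8) := by
        rw [← ENNReal.ofReal_mul (by norm_num)]; congr 1; ring
    _ ≤ ENNReal.ofReal 8 * (ENNReal.ofReal 3721 * _) := mul_le_mul' le_rfl hfin
    _ = ENNReal.ofReal (8 * 3721) * _ := by rw [ENNReal.ofReal_mul (by norm_num), mul_assoc]
    _ ≤ _ := mul_le_mul' (ENNReal.ofReal_le_ofReal (by norm_num)) le_rfl

lemma eLpNorm_fun_sum_le {X ι : Type*} [MeasurableSpace X] [Fintype ι] {μ : Measure X}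
    {f : ι → X → ℝ} (hf : ∀ i, AEStronglyMeasurable (f i) μ) :
    eLpNorm (fun x => ∑ i, f i x) 2 μ ≤ ∑ i, eLpNorm (f i) 2 μ := by
  have := eLpNorm_sum_le (s := Finset.univ) (p := 2) (fun i _ => hf i) (by norm_num)
  rwa [Finset.sum_fn] at this

lemma eLpNorm_sum_abs_le {X ι : Type*} [TopologicalSpace X] [MeasurableSpace X]
    [OpensMeasurableSpace X] [SecondCountableTopology X] [Fintype ι] {μ : Measure X}
    {f : ι → X → ℝ} (hf : ∀ i, Continuous (f i)) :
    eLpNorm (fun x => ∑ i, |f i x|) 2 μ ≤ ∑ i, eLpNorm (f i) 2 μ := by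
  refine (eLpNorm_fun_sum_le fun i => (hf i).abs.aestronglyMeasurable).trans ?_
  exact Finset.sum_le_sum fun i _ => (eLpNorm_norm (f i)).le

lemma eLpNorm_derivSum_le {u : E3 → ℝ} (hu : ContDiff ℝ (⊤ : ℕ∞) u) (μ : Measure E3) :
    eLpNorm (derivSum u) 2 μ ≤ eLpNorm u 2 μ + ∑ a, eLpNorm (pd3 a u) 2 μ
      + ∑ q, eLpNorm (rot3 q u) 2 μ + ∑ a, ∑ b, eLpNorm (pd3 a (pd3 b u)) 2 μ
      + ∑ a, ∑ q, eLpNorm (pd3 a (rot3 q u)) 2 μ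
      + ∑ q, ∑ q', eLpNorm (rot3 q (rot3 q' u)) 2 μ := by
  have h0 := hu.continuous
  have h1 := fun i => (contDiff_pd3 hu i).continuous
  have h2 := fun q => (contDiff_rot3 hu q).continuous
  have h3 := fun j i => (contDiff_pd3 (contDiff_pd3 hu i) j).continuous
  have h4 := fun j q => (contDiff_pd3 (contDiff_rot3 hu q) j).continuous
  have h5 := fun q' q => (contDiff_rot3 (contDiff_rot3 hu q) q').continuous
  have hadd : ∀ {f g : E3 → ℝ} {A B : ℝ≥0∞}, Continuous f → Continuous g → eLpNorm f 2 μ ≤ A →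
      eLpNorm g 2 μ ≤ B → eLpNorm (fun x => f x + g x) 2 μ ≤ A + B := fun hf hg hA hB =>
    (eLpNorm_add_le hf.aestronglyMeasurable hg.aestronglyMeasurable (by norm_num)).trans
      (add_le_add hA hB)
  unfold derivSum
  refine hadd (by fun_prop) (by fun_prop) (hadd (by fun_prop) (by fun_prop)
    (hadd (by fun_prop) (by fun_prop) (hadd (by fun_prop) (by fun_prop)
    (hadd (by fun_prop) (by fun_prop) (eLpNorm_norm u).le ?_) ?_) ?_) ?_) ?_
  · exact eLpNorm_sum_abs_le h1
  · exact eLpNorm_sum_abs_le h2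
  · exact (eLpNorm_fun_sum_le fun i => Continuous.aestronglyMeasurable (by fun_prop)).trans
      (Finset.sum_le_sum fun i _ => eLpNorm_sum_abs_le (h3 i))
  · exact (eLpNorm_fun_sum_le fun i => Continuous.aestronglyMeasurable (by fun_prop)).trans
      (Finset.sum_le_sum fun i _ => eLpNorm_sum_abs_le (h4 i))
  · exact (eLpNorm_fun_sum_le fun i => Continuous.aestronglyMeasurable (by fun_prop)).trans
      (Finset.sum_le_sum fun i _ => eLpNorm_sum_abs_le (h5 i))

lemma nnnorm_le_eLpNorm_derivSum {u : E3 → ℝ} (hu : ContDiff ℝ (⊤ : ℕ∞) u) {R : ℝ} (hR : 1 ≤ R)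
    {x : E3} (hx : R ≤ ‖x‖) :
    (‖u x‖₊ : ℝ≥0∞) ≤ ENNReal.ofReal (400 * (1 + ‖x‖)⁻¹) *
      eLpNorm (derivSum u) 2 (volume.restrict {y : E3 | R ≤ ‖y‖}) := by
  have hx1 : 1 ≤ ‖x‖ := hR.trans hx
  set N := eLpNorm (derivSum u) 2 (volume.restrict {y : E3 | R ≤ ‖y‖}) with hN
  have hN2 : ∫⁻ y in {y : E3 | ‖x‖ ≤ ‖y‖}, ENNReal.ofReal (derivSum u y ^ 2) ≤ N ^ 2 := by
    have h := eLpNorm_nnreal_pow_eq_lintegral (p := 2) (f := derivSum u)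
      (μ := volume.restrict {y : E3 | R ≤ ‖y‖}) two_ne_zero
    have h' : N ^ 2 = ∫⁻ y in {y : E3 | R ≤ ‖y‖}, ENNReal.ofReal (derivSum u y ^ 2) := by
      have e : N ^ 2 = N ^ ((2 : ℝ≥0) : ℝ) := by simp
      rw [e, hN]
      refine h.trans (lintegral_congr fun y => ?_)
      simp [← ofReal_norm, ← ENNReal.ofReal_pow]
    rw [h']
    exact lintegral_mono_set fun y hy => hx.trans hy
  have h1 : ENNReal.ofReal (‖x‖ * |u x|) ^ 2 ≤ (ENNReal.ofReal 200 * N) ^ 2 := by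
    rw [← ENNReal.ofReal_pow (by positivity), mul_pow, sq_abs, mul_pow,
      ← ENNReal.ofReal_pow (by norm_num)]
    refine (ofReal_sq_le_lintegral hu (by linarith)).trans ?_
    norm_num
    gcongr
  have h2 : ENNReal.ofReal (‖x‖ * |u x|) ≤ ENNReal.ofReal 200 * N :=
    (ENNReal.pow_le_pow_left_iff two_ne_zero).1 h1
  have h3 : (‖u x‖₊ : ℝ≥0∞) = ENNReal.ofReal ‖x‖⁻¹ * ENNReal.ofReal (‖x‖ * |u x|) := by
    rw [← ENNReal.ofReal_mul (by positivity), inv_mul_cancel_left₀ (by linarith)]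
    exact (ofReal_norm (u x)).symm
  rw [h3]
  calc _ ≤ ENNReal.ofReal ‖x‖⁻¹ * (ENNReal.ofReal 200 * N) := by gcongr
    _ = ENNReal.ofReal (‖x‖⁻¹ * 200) * N := by
        rw [ENNReal.ofReal_mul (by positivity), mul_assoc]
    _ ≤ _ := by
        refine mul_le_mul' (ENNReal.ofReal_le_ofReal ?_) le_rfl
        rw [inv_mul_eq_div, ← div_eq_mul_inv, div_le_div_iff₀ (by linarith) (by linarith)]
        linarith

/-- Weighted Sobolev estimate on exterior regions `{|y| ≥ R}`, `R ≥ 1`, with a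
constant independent of `R`:
`|u(x)| ≤ C (1+|x|)⁻¹ Σ_{|I|+|J| ≤ 2} ‖∂^I Ω^J u‖_{L²({|y| ≥ R})}`, the sum over
`|I|+|J| ≤ 2` being written out termwise (the L² norms may be `+∞`). -/
theorem stmt2 :
    ∃ C : ℝ, 0 < C ∧
      ∀ R : ℝ, 1 ≤ R → ∀ u : E3 → ℝ, ContDiff ℝ (⊤ : ℕ∞) u →
        ∀ x : E3, R ≤ ‖x‖ →
          (‖u x‖₊ : ℝ≥0∞) ≤ ENNReal.ofReal (C * (1 + ‖x‖)⁻¹) *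
            ( eLpNorm u 2 (volume.restrict {y : E3 | R ≤ ‖y‖})
              + ∑ a : Fin 3, eLpNorm (pd3 a u) 2 (volume.restrict {y : E3 | R ≤ ‖y‖})
              + ∑ q : Fin 3 × Fin 3,
                  eLpNorm (rot3 q u) 2 (volume.restrict {y : E3 | R ≤ ‖y‖})
              + ∑ a : Fin 3, ∑ b : Fin 3,
                  eLpNorm (pd3 a (pd3 b u)) 2 (volume.restrict {y : E3 | R ≤ ‖y‖})
              + ∑ a : Fin 3, ∑ q : Fin 3 × Fin 3,
                  eLpNorm (pd3 a (rot3 q u)) 2 (volume.restrict {y : E3 | R ≤ ‖y‖})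
              + ∑ q : Fin 3 × Fin 3, ∑ q' : Fin 3 × Fin 3,
                  eLpNorm (rot3 q (rot3 q' u)) 2 (volume.restrict {y : E3 | R ≤ ‖y‖}) ) := by
  refine ⟨400, by norm_num, fun R hR u hu x hx => ?_⟩
  exact (nnnorm_le_eLpNorm_derivSum hu hR hx).trans (by gcongr; exact eLpNorm_derivSum_le hu _)
end
end

section
/- There exists a constant C > 0 such that for every s ≥ 2, every smooth function u defined on {(t,x) ∈ ℝ × ℝ³ : t > 0}, and every x₀ ∈ ℝ³ with |x₀| ≤ −1 + s²/2, one has (s² + |x₀|²)^{3/4} |u(√(s² + |x₀|²), x₀)| ≤ C Σ_{|J| ≤ 2} ( ∫_{ℝ³} |(L^J u)(√(s² + |y|²), y)|² dy )^{1/2}, where L^J ranges over compositions of at most two Lorentz boosts. -/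
noncomputable section
open MeasureTheory
open scoped ENNReal NNReal

/-- The time derivative `∂_t` on `ℝ × ℝ³`. -/
def pdt (u : ℝ × E3 → ℝ) : ℝ × E3 → ℝ := fun p => fderiv ℝ u p (1, 0)

/-- The spatial derivative `∂_a` on `ℝ × ℝ³`. -/
def pdx (a : Fin 3) (u : ℝ × E3 → ℝ) : ℝ × E3 → ℝ :=
  fun p => fderiv ℝ u p (0, EuclideanSpace.single a 1)

/-- The Lorentz boost `L_a = xᵃ∂_t + t∂_a`. -/
def Lb (a : Fin 3) (u : ℝ × E3 → ℝ) : ℝ × E3 → ℝ :=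
  fun p => p.2 a * pdt u p + p.1 * pdx a u p

/-- Integration in polar coordinates for the Lebesgue integral of a nonnegative function. -/
theorem lintegral_eq_lintegral_toSphere {E : Type*} [NormedAddCommGroup E] [NormedSpace ℝ E]
    [MeasurableSpace E] [BorelSpace E] [FiniteDimensional ℝ E] [Nontrivial E] (μ : Measure E)
    [μ.IsAddHaarMeasure] {f : E → ℝ≥0∞} (hf : Measurable f) :
    ∫⁻ x, f x ∂μ = ∫⁻ ω : Metric.sphere (0 : E) 1, (∫⁻ r in Set.Ioi (0 : ℝ),
      ENNReal.ofReal (r ^ (Module.finrank ℝ E - 1)) * f (r • (ω : E))) ∂μ.toSphere := by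
  have hg : Measurable fun p : Metric.sphere (0 : E) 1 × Set.Ioi (0 : ℝ) =>
      f ((p.2 : ℝ) • (p.1 : E)) := by
    refine hf.comp (Continuous.measurable ?_)
    fun_prop
  calc ∫⁻ x, f x ∂μ = ∫⁻ x : ({0}ᶜ : Set E), f x ∂(μ.comap (↑)) := by
        rw [lintegral_subtype_comap (measurableSet_singleton _).compl,
          restrict_compl_singleton]
    _ = ∫⁻ p, f ((p.2 : ℝ) • (p.1 : E))
          ∂μ.toSphere.prod (.volumeIoiPow (Module.finrank ℝ E - 1)) := by
        rw [← μ.measurePreserving_homeomorphUnitSphereProd.lintegral_comp hg]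
        refine lintegral_congr fun x => ?_
        have hx : ‖(x : E)‖ ≠ 0 := norm_ne_zero_iff.2 x.2
        simp [smul_smul, hx]
    _ = _ := by
        rw [lintegral_prod _ hg.aemeasurable]
        refine lintegral_congr fun ω => ?_
        have hω : Measurable fun r : ℝ => f (r • (ω : E)) :=
          hf.comp (Continuous.measurable (by fun_prop))
        refine (lintegral_withDensity_eq_lintegral_mul _ (by fun_prop)
          (hω.comp measurable_subtype_coe)).trans ?_
        exact lintegral_subtype_comap measurableSet_Ioi
          fun r : ℝ => ENNReal.ofReal (r ^ (Module.finrank ℝ E - 1)) * f (r • (ω : E))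

/-- The Cauchy-Schwarz inequality on an interval, against the constant function. -/
theorem sq_intervalIntegral_le {f : ℝ → ℝ} (hf : Continuous f) {R : ℝ} (hR : 0 < R) :
    (∫ r in (0 : ℝ)..R, f r) ^ 2 ≤ R * ∫ r in (0 : ℝ)..R, f r ^ 2 := by
  set I := ∫ r in (0 : ℝ)..R, f r with hI
  have h : 0 ≤ ∫ r in (0 : ℝ)..R, (f r - I / R) ^ 2 :=
    intervalIntegral.integral_nonneg hR.le fun _ _ => sq_nonneg _
  have e : ∫ r in (0 : ℝ)..R, (f r - I / R) ^ 2 =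
      (∫ r in (0 : ℝ)..R, f r ^ 2) - I ^ 2 / R := by
    calc ∫ r in (0 : ℝ)..R, (f r - I / R) ^ 2
        = ∫ r in (0 : ℝ)..R, ((f r ^ 2 - 2 * (I / R) * f r) + (I / R) ^ 2) := by
          congr 1; ext r; ring
      _ = _ := by
          rw [intervalIntegral.integral_add, intervalIntegral.integral_sub,
            intervalIntegral.integral_const_mul, intervalIntegral.integral_const, ← hI]
          · simp only [sub_zero, smul_eq_mul]
            field_simp
            ring
          all_goals exact Continuous.intervalIntegrable (by fun_prop) _ _
  rw [e, sub_nonneg, div_le_iff₀ hR] at h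
  linarith

/-- A function is recovered at the origin from its 2-jet on `[0, R]`, with a weight vanishing
at the origin: integrate by parts twice against the cutoff `(1 - r / R) ^ 2`. -/
theorem eq_intervalIntegral_of_hasDerivAt_two {h h₁ h₂ : ℝ → ℝ}
    (hh : ∀ r, HasDerivAt h (h₁ r) r) (hh₁ : ∀ r, HasDerivAt h₁ (h₂ r) r) (hc : Continuous h₂)
    {R : ℝ} (hR : 0 < R) :
    h 0 = ∫ r in (0 : ℝ)..R,
      r * ((1 - r / R) ^ 2 * h₂ r - 4 / R * (1 - r / R) * h₁ r + 2 / R ^ 2 * h r) := by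
  have c : Continuous h := continuous_iff_continuousAt.2 fun r => (hh r).continuousAt
  have c₁ : Continuous h₁ := continuous_iff_continuousAt.2 fun r => (hh₁ r).continuousAt
  rw [intervalIntegral.integral_eq_sub_of_hasDerivAt
    (f := fun r => r * ((1 - r / R) ^ 2 * h₁ r - 2 / R * (1 - r / R) * h r)
      - (1 - r / R) ^ 2 * h r)]
  · simp [hR.ne']
  · intro r _
    have hk : HasDerivAt (fun r : ℝ => 1 - r / R) (-(1 / R)) r :=
      ((hasDerivAt_id r).div_const R).const_sub 1
    have hd := ((hasDerivAt_id r).mul (((hk.pow 2).mul (hh₁ r)).sub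
      ((hk.const_mul (2 / R)).mul (hh r)))).sub ((hk.pow 2).mul (hh r))
    refine hd.congr_deriv ?_
    simp only [id, Pi.pow_apply, Pi.mul_apply, Pi.sub_apply, Nat.cast_ofNat, Nat.add_one_sub_one, pow_one]
    field_simp
    ring
  · exact Continuous.intervalIntegrable (by fun_prop) _ _

/-- A weighted one-dimensional Sobolev inequality, scaling as in dimension three. -/
theorem cube_mul_sq_le_intervalIntegral {h h₁ h₂ g : ℝ → ℝ}
    (hh : ∀ r, HasDerivAt h (h₁ r) r) (hh₁ : ∀ r, HasDerivAt h₁ (h₂ r) r) (hc : Continuous h₂)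
    (hg : Continuous g) {R : ℝ} (hR : 0 < R) (b : ∀ r ∈ Set.Icc 0 R, |h r| ≤ g r)
    (b₁ : ∀ r ∈ Set.Icc 0 R, |h₁ r| ≤ g r / R) (b₂ : ∀ r ∈ Set.Icc 0 R, |h₂ r| ≤ g r / R ^ 2) :
    R ^ 3 * h 0 ^ 2 ≤ 49 * ∫ r in (0 : ℝ)..R, r ^ 2 * g r ^ 2 := by
  have key : |h 0| ≤ ∫ r in (0 : ℝ)..R, 7 / R ^ 2 * (r * g r) := by
    rw [eq_intervalIntegral_of_hasDerivAt_two hh hh₁ hc hR, ← Real.norm_eq_abs]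
    refine intervalIntegral.norm_integral_le_of_norm_le hR.le (ae_of_all _ fun r hr => ?_)
      (Continuous.intervalIntegrable (by fun_prop) _ _)
    have hr' : r ∈ Set.Icc 0 R := ⟨hr.1.le, hr.2⟩
    have k0 : 0 ≤ 1 - r / R := sub_nonneg.2 ((div_le_one hR).2 hr.2)
    have k1 : 1 - r / R ≤ 1 := sub_le_self _ (div_nonneg hr.1.le hR.le)
    have t₂ : |(1 - r / R) ^ 2 * h₂ r| ≤ g r / R ^ 2 := by
      rw [abs_mul, abs_of_nonneg (pow_nonneg k0 2)]
      exact (mul_le_of_le_one_left (abs_nonneg _) (pow_le_one₀ k0 k1)).trans (b₂ r hr')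
    have t₁ : |4 / R * (1 - r / R) * h₁ r| ≤ 4 / R * (g r / R) := by
      rw [abs_mul, abs_mul, abs_of_nonneg k0, abs_of_pos (by positivity : 0 < 4 / R), mul_assoc]
      gcongr
      exact (mul_le_of_le_one_left (abs_nonneg _) k1).trans (b₁ r hr')
    have t₀ : |2 / R ^ 2 * h r| ≤ 2 / R ^ 2 * g r := by
      rw [abs_mul, abs_of_pos (by positivity : 0 < 2 / R ^ 2)]
      gcongr
      exact b r hr'
    rw [Real.norm_eq_abs, abs_mul, abs_of_pos hr.1]
    calc r * |(1 - r / R) ^ 2 * h₂ r - 4 / R * (1 - r / R) * h₁ r + 2 / R ^ 2 * h r|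
        ≤ r * (g r / R ^ 2 + 4 / R * (g r / R) + 2 / R ^ 2 * g r) := by
          refine mul_le_mul_of_nonneg_left ?_ hr.1.le
          exact (abs_add_le _ _).trans (add_le_add ((abs_sub _ _).trans (add_le_add t₂ t₁)) t₀)
      _ = 7 / R ^ 2 * (r * g r) := by field_simp; ring
  rw [intervalIntegral.integral_const_mul] at key
  have hcs := sq_intervalIntegral_le (f := fun r => r * g r) (by fun_prop) hR
  simp only [mul_pow] at hcs
  have h2 : h 0 ^ 2 ≤ (7 / R ^ 2 * ∫ r in (0 : ℝ)..R, r * g r) ^ 2 :=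
    sq_le_sq' (neg_le_of_abs_le key) (le_of_abs_le key)
  calc R ^ 3 * h 0 ^ 2 ≤ R ^ 3 * (7 / R ^ 2 * ∫ r in (0 : ℝ)..R, r * g r) ^ 2 := by gcongr
    _ = 49 / R * (∫ r in (0 : ℝ)..R, r * g r) ^ 2 := by field_simp; ring
    _ ≤ 49 / R * (R * ∫ r in (0 : ℝ)..R, r ^ 2 * g r ^ 2) := by gcongr
    _ = _ := by field_simp

/-- The open upper half-space `t > 0`. -/
def upperHalf : Set (ℝ × E3) := {p | 0 < p.1}

theorem isOpen_upperHalf : IsOpen upperHalf := isOpen_lt continuous_const continuous_fst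

/-- The time coordinate of the point of the hyperboloid of parameter `s` over `y`. -/
def hypTime (s : ℝ) (y : E3) : ℝ := Real.sqrt (s ^ 2 + ‖y‖ ^ 2)

/-- The restriction of a function to the hyperboloid of parameter `s`, in the coordinate `y`. -/
def hypRestrict (s : ℝ) (f : ℝ × E3 → ℝ) (y : E3) : ℝ := f (hypTime s y, y)

theorem hypTime_sq (s : ℝ) (y : E3) : hypTime s y ^ 2 = s ^ 2 + ‖y‖ ^ 2 :=
  Real.sq_sqrt (by positivity)

theorem hypTime_pos {s : ℝ} (hs : 0 < s) (y : E3) : 0 < hypTime s y :=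
  Real.sqrt_pos.2 (by positivity)

theorem norm_le_hypTime (s : ℝ) (y : E3) : ‖y‖ ≤ hypTime s y :=
  Real.le_sqrt_of_sq_le (by nlinarith [sq_nonneg s])

theorem continuous_hypTime (s : ℝ) : Continuous (hypTime s) := by
  unfold hypTime
  fun_prop

theorem hypTime_le_add_norm (s : ℝ) (y z : E3) : hypTime s y ≤ hypTime s (y + z) + ‖z‖ := by
  have h := norm_le_hypTime s (y + z)
  have hy : ‖y‖ ≤ ‖y + z‖ + ‖z‖ := by simpa using norm_sub_le (y + z) z
  refine Real.sqrt_le_iff.2 ⟨add_nonneg ((norm_nonneg _).trans h) (norm_nonneg _), ?_⟩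
  have := hypTime_sq s (y + z)
  nlinarith [norm_nonneg z, norm_nonneg y, mul_le_mul_of_nonneg_right h (norm_nonneg z),
    mul_self_le_mul_self (norm_nonneg y) hy]

theorem hasDerivAt_hypTime {s : ℝ} (hs : 0 < s) (x v : E3) (r : ℝ) :
    HasDerivAt (fun r : ℝ => hypTime s (x + r • v))
      (inner ℝ (x + r • v) v / hypTime s (x + r • v)) r := by
  have hl : HasDerivAt (fun r : ℝ => x + r • v) v r := by
    simpa using ((hasDerivAt_id r).smul_const v).const_add x
  have h := (hl.norm_sq.const_add (s ^ 2)).sqrt (by positivity)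
  refine h.congr_deriv ?_
  change 2 * _ / (2 * hypTime s (x + r • v)) = _
  rw [mul_div_mul_left _ _ two_ne_zero]

theorem contDiffOn_Lb {u : ℝ × E3 → ℝ} (hu : ContDiffOn ℝ (⊤ : ℕ∞) u upperHalf) (a : Fin 3) :
    ContDiffOn ℝ (⊤ : ℕ∞) (Lb a u) upperHalf := by
  have hd : ContDiffOn ℝ (⊤ : ℕ∞) (fderiv ℝ u) upperHalf :=
    hu.fderiv_of_isOpen isOpen_upperHalf (by simp)
  unfold Lb pdt pdx
  have h1 : ContDiff ℝ (⊤ : ℕ∞) fun p : ℝ × E3 => p.2 a := by fun_prop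
  exact (h1.contDiffOn.mul (hd.clm_apply contDiffOn_const)).add
    (contDiff_fst.contDiffOn.mul (hd.clm_apply contDiffOn_const))

theorem continuous_hypRestrict {s : ℝ} (hs : 0 < s) {f : ℝ × E3 → ℝ}
    (hf : ContDiffOn ℝ (⊤ : ℕ∞) f upperHalf) : Continuous (hypRestrict s f) :=
  hf.continuousOn.comp_continuous ((continuous_hypTime s).prodMk continuous_id)
    fun y => hypTime_pos hs y

/-- On the hyperboloid, the boost `L_a` acts as `t ∂_a`. -/
theorem hasDerivAt_hypRestrict {s : ℝ} (hs : 0 < s) {f : ℝ × E3 → ℝ}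
    (hf : ContDiffOn ℝ (⊤ : ℕ∞) f upperHalf) (x v : E3) (r : ℝ) :
    HasDerivAt (fun r : ℝ => hypRestrict s f (x + r • v))
      ((∑ a, v a * hypRestrict s (Lb a f) (x + r • v)) / hypTime s (x + r • v)) r := by
  have hl : HasDerivAt (fun r : ℝ => x + r • v) v r := by
    simpa using ((hasDerivAt_id r).smul_const v).const_add x
  have ht := hypTime_pos hs (x + r • v)
  have hfd : HasFDerivAt f (fderiv ℝ f (hypTime s (x + r • v), x + r • v))
      (hypTime s (x + r • v), x + r • v) :=
    ((hf.contDiffAt (isOpen_upperHalf.mem_nhds ht)).differentiableAt (by simp)).hasFDerivAt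
  refine (hfd.comp_hasDerivAt r ((hasDerivAt_hypTime hs x v r).prodMk hl)).congr_deriv ?_
  generalize x + r • v = y at ht
  have hv : ((inner ℝ y v / hypTime s y, v) : ℝ × E3) =
      (inner ℝ y v / hypTime s y) • ((1, 0) : ℝ × E3) +
        ∑ a, v a • ((0, EuclideanSpace.single a 1) : ℝ × E3) := by
    refine Prod.ext ?_ ?_
    · simp [Prod.fst_sum]
    · ext i
      simp [Fin.sum_univ_three]
      fin_cases i <;> simp
  rw [hv, map_add, map_smul, map_sum]
  simp only [map_smul, smul_eq_mul, hypRestrict, Lb, pdt, pdx, PiLp.inner_apply,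
    Fin.sum_univ_three, RCLike.inner_apply, conj_trivial]
  field_simp
  ring

/-- The sum of the absolute values of all boost derivatives of order at most two, restricted to
the hyperboloid. -/
def boostJet (s : ℝ) (u : ℝ × E3 → ℝ) (y : E3) : ℝ :=
  |hypRestrict s u y| + ∑ a : Fin 3, |hypRestrict s (Lb a u) y| +
    ∑ a : Fin 3, ∑ b : Fin 3, |hypRestrict s (Lb a (Lb b u)) y|

theorem continuous_boostJet {s : ℝ} (hs : 0 < s) {u : ℝ × E3 → ℝ}
    (hu : ContDiffOn ℝ (⊤ : ℕ∞) u upperHalf) : Continuous (boostJet s u) := by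
  refine ((continuous_hypRestrict hs hu).abs.add (continuous_finsetSum _ fun a _ => ?_)).add
    (continuous_finsetSum _ fun a _ => continuous_finsetSum _ fun b _ => ?_)
  · exact (continuous_hypRestrict hs (contDiffOn_Lb hu a)).abs
  · exact (continuous_hypRestrict hs (contDiffOn_Lb (contDiffOn_Lb hu b) a)).abs

theorem boostJet_nonneg (s : ℝ) (u : ℝ × E3 → ℝ) (y : E3) : 0 ≤ boostJet s u y := by
  unfold boostJet
  positivity

/-- The weighted Sobolev inequality along a ray of the hyperboloid. -/
theorem hypTime_cube_mul_sq_le {s : ℝ} (hs : 0 < s) {u : ℝ × E3 → ℝ}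
    (hu : ContDiffOn ℝ (⊤ : ℕ∞) u upperHalf) (x : E3) {v : E3} (hv : ‖v‖ = 1) :
    hypTime s x ^ 3 * hypRestrict s u x ^ 2 ≤
      392 * ∫ r in (0 : ℝ)..(hypTime s x / 2), r ^ 2 * boostJet s u (x + r • v) ^ 2 := by
  have hT := hypTime_pos hs
  have cl : Continuous fun r : ℝ => x + r • v := by fun_prop
  have cT : Continuous fun r : ℝ => hypTime s (x + r • v) := (continuous_hypTime s).comp cl
  have ne : ∀ r : ℝ, hypTime s (x + r • v) ≠ 0 := fun r => (hT _).ne'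
  have hva : ∀ a, |v a| ≤ 1 := fun a => hv ▸ PiLp.norm_apply_le v a
  set N : ℝ → ℝ := fun r => ∑ a, v a * hypRestrict s (Lb a u) (x + r • v) with hN
  set M : ℝ → ℝ := fun r => ∑ b, v b * ∑ a, v a * hypRestrict s (Lb a (Lb b u)) (x + r • v)
    with hM
  have cN : Continuous N := continuous_finsetSum _ fun a _ =>
    continuous_const.mul ((continuous_hypRestrict hs (contDiffOn_Lb hu a)).comp cl)
  have cM : Continuous M := continuous_finsetSum _ fun b _ =>
    continuous_const.mul (continuous_finsetSum _ fun a _ =>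
      continuous_const.mul ((continuous_hypRestrict hs (contDiffOn_Lb (contDiffOn_Lb hu b) a)).comp
        cl))
  have hNd : ∀ r, HasDerivAt N (M r / hypTime s (x + r • v)) r := by
    intro r
    refine (HasDerivAt.fun_sum fun b _ =>
      (hasDerivAt_hypRestrict hs (contDiffOn_Lb hu b) x v r).const_mul (v b)).congr_deriv ?_
    simp only [hM, Finset.sum_div, mul_div_assoc]
  have bN : ∀ r, |N r| ≤ ∑ a, |hypRestrict s (Lb a u) (x + r • v)| := fun r =>
    (Finset.abs_sum_le_sum_abs _ _).trans <| Finset.sum_le_sum fun a _ => by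
      rw [abs_mul]
      exact mul_le_of_le_one_left (abs_nonneg _) (hva a)
  have bM : ∀ r, |M r| ≤ ∑ a, ∑ b, |hypRestrict s (Lb a (Lb b u)) (x + r • v)| := fun r => by
    rw [Finset.sum_comm]
    refine (Finset.abs_sum_le_sum_abs _ _).trans <| Finset.sum_le_sum fun b _ => ?_
    rw [abs_mul]
    refine (mul_le_of_le_one_left (abs_nonneg _) (hva b)).trans <|
      (Finset.abs_sum_le_sum_abs _ _).trans <| Finset.sum_le_sum fun a _ => ?_
    rw [abs_mul]
    exact mul_le_of_le_one_left (abs_nonneg _) (hva a)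
  have hR : 0 < hypTime s x / 2 := half_pos (hT x)
  have lower : ∀ r ∈ Set.Icc 0 (hypTime s x / 2), hypTime s x / 2 ≤ hypTime s (x + r • v) := by
    intro r hr
    have := hypTime_le_add_norm s x (r • v)
    rw [norm_smul, hv, mul_one, Real.norm_eq_abs, abs_of_nonneg hr.1] at this
    linarith [hr.2]
  have key := cube_mul_sq_le_intervalIntegral (R := hypTime s x / 2)
    (h := fun r : ℝ => hypRestrict s u (x + r • v))
    (h₁ := fun r => N r / hypTime s (x + r • v))
    (h₂ := fun r => (M r / hypTime s (x + r • v) * hypTime s (x + r • v) -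
      N r * (inner ℝ (x + r • v) v / hypTime s (x + r • v))) / hypTime s (x + r • v) ^ 2)
    (g := fun r => boostJet s u (x + r • v))
    (fun r => hasDerivAt_hypRestrict hs hu x v r)
    (fun r => (hNd r).div (hasDerivAt_hypTime hs x v r) (ne r))
    (Continuous.div (((cM.div cT ne).mul cT).sub (cN.mul ((cl.inner continuous_const).div cT ne)))
      (cT.pow 2) fun r => pow_ne_zero 2 (ne r))
    ((continuous_boostJet hs hu).comp cl) hR ?_ ?_ ?_
  · simp only [zero_smul, add_zero, div_pow] at key
    linarith
  · intro r _
    simp only [boostJet]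
    have : 0 ≤ ∑ a, |hypRestrict s (Lb a u) (x + r • v)| := by positivity
    have : 0 ≤ ∑ a, ∑ b, |hypRestrict s (Lb a (Lb b u)) (x + r • v)| := by positivity
    linarith
  · intro r hr
    rw [abs_div, abs_of_pos (hT _)]
    refine div_le_div₀ (boostJet_nonneg s u _) ?_ hR (lower r hr)
    refine (bN r).trans ?_
    simp only [boostJet]
    have : 0 ≤ ∑ a, ∑ b, |hypRestrict s (Lb a (Lb b u)) (x + r • v)| := by positivity
    linarith [abs_nonneg (hypRestrict s u (x + r • v))]
  · intro r hr
    rw [abs_div, abs_of_pos (pow_pos (hT _) 2), div_mul_cancel₀ _ (ne r)]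
    refine div_le_div₀ (boostJet_nonneg s u _) ?_ (pow_pos hR 2)
      (pow_le_pow_left₀ hR.le (lower r hr) 2)
    have hi : |inner ℝ (x + r • v) v / hypTime s (x + r • v)| ≤ 1 := by
      rw [abs_div, abs_of_pos (hT _), div_le_one (hT _)]
      refine (abs_real_inner_le_norm _ _).trans ?_
      rw [hv, mul_one]
      exact norm_le_hypTime s _
    have := (abs_sub (M r) (N r * (inner ℝ (x + r • v) v / hypTime s (x + r • v)))).trans
      (add_le_add (bM r) ((abs_mul _ _).le.trans
        ((mul_le_of_le_one_right (abs_nonneg _) hi).trans (bN r))))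
    simp only [boostJet]
    linarith [abs_nonneg (hypRestrict s u (x + r • v))]

/-- The Sobolev inequality on the hyperboloid, in squared form. -/
theorem hypTime_cube_mul_sq_mul_toSphere_le {s : ℝ} (hs : 0 < s) {u : ℝ × E3 → ℝ}
    (hu : ContDiffOn ℝ (⊤ : ℕ∞) u upperHalf) (x : E3) :
    ENNReal.ofReal (hypTime s x ^ 3 * hypRestrict s u x ^ 2) *
        (volume : Measure E3).toSphere Set.univ ≤
      ENNReal.ofReal 392 * eLpNorm (boostJet s u) 2 volume ^ 2 := by
  have cG := continuous_boostJet hs hu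
  have hG : Measurable fun y => ENNReal.ofReal (boostJet s u (x + y) ^ 2) :=
    (Continuous.measurable (by fun_prop)).ennreal_ofReal
  have e : eLpNorm (boostJet s u) 2 volume ^ 2 =
      ∫⁻ y, ENNReal.ofReal (boostJet s u (x + y) ^ 2) := by
    have h := eLpNorm_nnreal_pow_eq_lintegral (f := boostJet s u) (μ := volume) (p := 2)
      two_ne_zero
    simp only [NNReal.coe_ofNat, ENNReal.coe_ofNat, ENNReal.rpow_ofNat] at h
    rw [h, lintegral_add_left_eq_self (fun y => ENNReal.ofReal (boostJet s u y ^ 2)) x]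
    refine lintegral_congr fun y => ?_
    rw [Real.enorm_of_nonneg (boostJet_nonneg s u y), ENNReal.ofReal_pow (boostJet_nonneg s u y)]
  rw [e, lintegral_eq_lintegral_toSphere volume hG, ← lintegral_const_mul' _ _ ENNReal.ofReal_ne_top,
    ← lintegral_const]
  refine lintegral_mono fun ω => ?_
  have hω : ‖(ω : E3)‖ = 1 := by simp
  refine (ENNReal.ofReal_le_ofReal (hypTime_cube_mul_sq_le hs hu x hω)).trans ?_
  rw [ENNReal.ofReal_mul (by norm_num)]
  refine mul_le_mul_right ?_ _
  have hR : 0 ≤ hypTime s x / 2 := (half_pos (hypTime_pos hs x)).le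
  rw [intervalIntegral.integral_of_le hR, ofReal_integral_eq_lintegral_ofReal
    (Continuous.integrableOn_Ioc (by fun_prop)) (ae_of_all _ fun r => by positivity)]
  refine (lintegral_mono_set Set.Ioc_subset_Ioi_self).trans (lintegral_mono fun r => ?_)
  rw [finrank_euclideanSpace_fin, ENNReal.ofReal_mul (by positivity)]

theorem eLpNorm_boostJet_le {s : ℝ} (hs : 0 < s) {u : ℝ × E3 → ℝ}
    (hu : ContDiffOn ℝ (⊤ : ℕ∞) u upperHalf) :
    eLpNorm (boostJet s u) 2 volume ≤
      eLpNorm (hypRestrict s u) 2 volume +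
        ∑ a : Fin 3, eLpNorm (hypRestrict s (Lb a u)) 2 volume +
        ∑ a : Fin 3, ∑ b : Fin 3, eLpNorm (hypRestrict s (Lb a (Lb b u))) 2 volume := by
  have m : ∀ {f : ℝ × E3 → ℝ}, ContDiffOn ℝ (⊤ : ℕ∞) f upperHalf →
      AEStronglyMeasurable (fun y => |hypRestrict s f y|) (volume : Measure E3) :=
    fun hf => (continuous_hypRestrict hs hf).abs.aestronglyMeasurable
  have n : ∀ f : ℝ × E3 → ℝ, eLpNorm (fun y => |hypRestrict s f y|) 2 volume =
      eLpNorm (hypRestrict s f) 2 volume := fun f => by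
    simpa only [Real.norm_eq_abs] using eLpNorm_norm (μ := volume) (p := 2) (hypRestrict s f)
  have m₁ := fun a => m (contDiffOn_Lb hu a)
  have m₂ := fun a b => m (contDiffOn_Lb (contDiffOn_Lb hu b) a)
  have eq : boostJet s u = ((fun y => |hypRestrict s u y|) +
      ∑ a : Fin 3, fun y => |hypRestrict s (Lb a u) y|) +
      ∑ a : Fin 3, ∑ b : Fin 3, fun y => |hypRestrict s (Lb a (Lb b u)) y| := by
    ext y
    simp [boostJet]
  have s₂ := fun a : Fin 3 => Finset.aestronglyMeasurable_sum Finset.univ fun b _ => m₂ a b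
  rw [eq, ← n u]
  simp only [← n (Lb _ _)]
  have h₀ := eLpNorm_add_le (p := 2)
    ((m hu).add (Finset.aestronglyMeasurable_sum Finset.univ fun a _ => m₁ a))
    (Finset.aestronglyMeasurable_sum Finset.univ fun a _ => s₂ a) one_le_two
  refine h₀.trans (add_le_add ?_ ?_)
  · refine (eLpNorm_add_le (m hu)
      (Finset.aestronglyMeasurable_sum Finset.univ fun a _ => m₁ a) one_le_two).trans ?_
    gcongr
    exact eLpNorm_sum_le (fun a _ => m₁ a) one_le_two
  · refine (eLpNorm_sum_le (fun a _ => s₂ a) one_le_two).trans ?_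
    gcongr with a
    exact eLpNorm_sum_le (fun b _ => m₂ a b) one_le_two

/-- Sobolev inequality on the hyperboloids `{t = √(s² + |x|²)}`:
`(s² + |x₀|²)^{3/4} |u(√(s² + |x₀|²), x₀)| ≤ C Σ_{|J| ≤ 2} ‖L^J u‖_{L²(hyperboloid)}`
for `s ≥ 2` and `|x₀| ≤ −1 + s²/2`, with `C` independent of `s` (the right-hand
side L² norms over the hyperboloid, w.r.t. `dx`, may be `+∞`). -/
theorem stmt3 :
    ∃ C : ℝ, 0 < C ∧
      ∀ s : ℝ, 2 ≤ s →
        ∀ u : ℝ × E3 → ℝ, ContDiffOn ℝ (⊤ : ℕ∞) u {p : ℝ × E3 | 0 < p.1} →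
          ∀ x₀ : E3, ‖x₀‖ ≤ -1 + s ^ 2 / 2 →
            ENNReal.ofReal
                ((s ^ 2 + ‖x₀‖ ^ 2) ^ ((3 : ℝ) / 4) *
                  |u (Real.sqrt (s ^ 2 + ‖x₀‖ ^ 2), x₀)|) ≤
              ENNReal.ofReal C *
                ( eLpNorm (fun y : E3 => u (Real.sqrt (s ^ 2 + ‖y‖ ^ 2), y)) 2 volume
                  + ∑ a : Fin 3,
                      eLpNorm (fun y : E3 => Lb a u (Real.sqrt (s ^ 2 + ‖y‖ ^ 2), y)) 2 volume
                  + ∑ a : Fin 3, ∑ b : Fin 3,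
                      eLpNorm (fun y : E3 => Lb a (Lb b u) (Real.sqrt (s ^ 2 + ‖y‖ ^ 2), y)) 2
                        volume ) := by
  set σ : ℝ := (volume : Measure E3).toSphere.real Set.univ with hσ
  have : NeZero (volume : Measure E3).toSphere := ⟨Measure.toSphere_ne_zero _⟩
  have σ_pos : 0 < σ := measureReal_univ_pos
  refine ⟨Real.sqrt (392 / σ), Real.sqrt_pos.2 (by positivity), fun s hs u hu x _ => ?_⟩
  have hs0 : 0 < s := by linarith
  refine le_trans ?_ (mul_le_mul_right (eLpNorm_boostJet_le hs0 hu) _)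
  change ENNReal.ofReal ((s ^ 2 + ‖x‖ ^ 2) ^ ((3 : ℝ) / 4) * |hypRestrict s u x|) ≤ _
  have hT := hypTime_pos hs0 x
  have hw : ((s ^ 2 + ‖x‖ ^ 2) ^ ((3 : ℝ) / 4)) ^ 2 = hypTime s x ^ 3 := by
    rw [← hypTime_sq, ← Real.rpow_natCast, ← Real.rpow_natCast, ← Real.rpow_natCast,
      ← Real.rpow_mul hT.le, ← Real.rpow_mul hT.le]
    norm_num
  have key := hypTime_cube_mul_sq_mul_toSphere_le hs0 hu x
  rw [← ofReal_measureReal, ← hσ, ← hw, ← sq_abs (hypRestrict s u x), ← mul_pow,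
    ENNReal.ofReal_pow (by positivity)] at key
  rw [← ENNReal.pow_le_pow_left_iff two_ne_zero, mul_pow, ← ENNReal.ofReal_pow (Real.sqrt_nonneg _),
    Real.sq_sqrt (by positivity), ENNReal.ofReal_div_of_pos σ_pos, ← ENNReal.mul_div_right_comm,
    ENNReal.le_div_iff_mul_le (.inl (ENNReal.ofReal_pos.2 σ_pos).ne') (.inl ENNReal.ofReal_ne_top)]
  exact key
end
end

section
/- Let R be an associative algebra over a commutative ring k, and let A : ι → R and B : κ → R be families indexed by finite types, such that for all α ∈ ι, β ∈ κ there exist scalars Γ(α,β,γ) ∈ k with [A_α, B_β] = Σ_{γ ∈ ι} Γ(α,β,γ) A_γ. Then for every α ∈ ι, every m ≥ 1, and every word w = B_{β₁} ⋯ B_{β_m} of length m in the family B, the commutator [A_α, w] lies in the k-submodule of R spanned by the elements A_γ · w′, where γ ∈ ι and w′ ranges over the words in B of length at most m − 1 (including the empty word 1). -/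
section WordSpan

variable {k R ι κ : Type*} [CommRing k] [Ring R] [Algebra k R]

/-- The `k`-span of the products `A γ * w` with `w` a word in `B` of length less than `n`. -/
def wordSpan (k : Type*) {R ι κ : Type*} [CommRing k] [Ring R] [Algebra k R]
    (A : ι → R) (B : κ → R) (n : ℕ) : Submodule k R :=
  Submodule.span k {x : R | ∃ γ : ι, ∃ l : List κ, l.length < n ∧ x = A γ * (l.map B).prod}

theorem mul_prod_mem_wordSpan (A : ι → R) (B : κ → R) {n : ℕ} (γ : ι) {l : List κ}
    (hl : l.length < n) : A γ * (l.map B).prod ∈ wordSpan k A B n :=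
  Submodule.subset_span ⟨γ, l, hl, rfl⟩

variable [Fintype ι] {A : ι → R} {B : κ → R}

theorem commutator_mul_prod_mem_wordSpan
    (h : ∀ α : ι, ∀ β : κ, ∃ Γ : ι → k, A α * B β - B β * A α = ∑ γ : ι, Γ γ • A γ)
    {n : ℕ} (α : ι) (β : κ) {l : List κ} (hl : l.length < n) :
    (A α * B β - B β * A α) * (l.map B).prod ∈ wordSpan k A B n := by
  obtain ⟨Γ, hΓ⟩ := h α β
  rw [hΓ, Finset.sum_mul]
  refine Submodule.sum_mem _ fun γ _ => ?_
  rw [smul_mul_assoc]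
  exact Submodule.smul_mem _ _ (mul_prod_mem_wordSpan A B γ hl)

theorem mul_mem_wordSpan_succ
    (h : ∀ α : ι, ∀ β : κ, ∃ Γ : ι → k, A α * B β - B β * A α = ∑ γ : ι, Γ γ • A γ)
    {n : ℕ} (β : κ) {x : R} (hx : x ∈ wordSpan k A B n) :
    B β * x ∈ wordSpan k A B (n + 1) := by
  suffices wordSpan k A B n ≤ (wordSpan k A B (n + 1)).comap (LinearMap.mulLeft k (B β)) from
    this hx
  refine Submodule.span_le.2 ?_
  rintro _ ⟨γ, l, hl, rfl⟩
  have key : B β * (A γ * (l.map B).prod) =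
      A γ * ((β :: l).map B).prod - (A γ * B β - B β * A γ) * (l.map B).prod := by
    simp only [List.map_cons, List.prod_cons]
    noncomm_ring
  change B β * (A γ * (l.map B).prod) ∈ wordSpan k A B (n + 1)
  rw [key]
  exact Submodule.sub_mem _ (mul_prod_mem_wordSpan A B γ (by simpa using hl))
    (commutator_mul_prod_mem_wordSpan h γ β (by lia))

theorem commutator_prod_mem_wordSpan
    (h : ∀ α : ι, ∀ β : κ, ∃ Γ : ι → k, A α * B β - B β * A α = ∑ γ : ι, Γ γ • A γ)
    (α : ι) (l : List κ) :
    A α * (l.map B).prod - (l.map B).prod * A α ∈ wordSpan k A B l.length := by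
  induction l with
  | nil => simp
  | cons β l ih =>
    have key : A α * ((β :: l).map B).prod - ((β :: l).map B).prod * A α =
        (A α * B β - B β * A α) * (l.map B).prod +
          B β * (A α * (l.map B).prod - (l.map B).prod * A α) := by
      simp only [List.map_cons, List.prod_cons]
      noncomm_ring
    rw [key]
    exact Submodule.add_mem _ (commutator_mul_prod_mem_wordSpan h α β (by simp))
      (mul_mem_wordSpan_succ h β ih)

end WordSpan

/-- Commutator of one element of the family `A` with a word in the family `B`.
If `[A_α, B_β] = Σ_γ Γ(α,β,γ) A_γ` with scalar coefficients, then for every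
word `w = B_{β₁} ⋯ B_{β_m}` of length `m ≥ 1`, the commutator `[A_α, w]` lies
in the `k`-submodule spanned by the elements `A_γ · w′` with `w′` a word in `B`
of length at most `m − 1`. -/
theorem stmt11 {k R ι κ : Type*} [CommRing k] [Ring R] [Algebra k R]
    [Fintype ι] [Fintype κ] (A : ι → R) (B : κ → R)
    (h : ∀ α : ι, ∀ β : κ, ∃ Γ : ι → k,
      A α * B β - B β * A α = ∑ γ : ι, Γ γ • A γ) :
    ∀ α : ι, ∀ l : List κ, 1 ≤ l.length →
      A α * (l.map B).prod - (l.map B).prod * A α ∈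
        Submodule.span k
          {x : R | ∃ γ : ι, ∃ l' : List κ, l'.length < l.length ∧
            x = A γ * (l'.map B).prod} := by
  exact fun α l _ => commutator_prod_mem_wordSpan h α l
end

section
/- Let R be an associative algebra over a commutative ring k, and let A : ι → R and B : κ → R be families indexed by finite types, such that for all α ∈ ι, β ∈ κ there exist scalars Γ(α,β,γ) ∈ k with [A_α, B_β] = Σ_{γ ∈ ι} Γ(α,β,γ) A_γ. Then for every word v of length n in the family A and every word w of length m ≥ 1 in the family B, the commutator [v, w] lies in the k-submodule of R spanned by the elements v′ · w′, where v′ ranges over the words in A of length exactly n and w′ over the words in B of length at most m − 1. -/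
/-- If the commutators `[A_α, b]` lie in the span of the family `A`, then the commutator with `b` of
a word in `A` lies in the span of the words in `A` of the same length. -/
theorem word_commutator_mem_span {k R ι : Type*} [CommRing k] [Ring R] [Algebra k R]
    (A : ι → R) (b : R)
    (h : ∀ α : ι, A α * b - b * A α ∈ Submodule.span k (Set.range A)) (la : List ι) :
    (la.map A).prod * b - b * (la.map A).prod ∈
      Submodule.span k {x : R | ∃ la' : List ι, la'.length = la.length ∧ x = (la'.map A).prod} := by
  induction la with
  | nil => simp
  | cons α la ih =>
    have key : ((α :: la).map A).prod * b - b * ((α :: la).map A).prod =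
        A α * ((la.map A).prod * b - b * (la.map A).prod) +
          (A α * b - b * A α) * (la.map A).prod := by
      simp only [List.map_cons, List.prod_cons]
      noncomm_ring
    rw [key]
    refine add_mem ?_ ?_
    · refine (Submodule.span_le (p := (Submodule.span k _).comap (LinearMap.mulLeft k (A α)))).2
        ?_ ih
      rintro _ ⟨la', hl, rfl⟩
      exact Submodule.subset_span ⟨α :: la', by simp [hl], by simp⟩
    · refine (Submodule.span_le (p := (Submodule.span k _).comap
        (LinearMap.mulRight k (la.map A).prod))).2 ?_ (h α)
      rintro _ ⟨γ, rfl⟩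
      exact Submodule.subset_span ⟨γ :: la, by simp, by simp⟩

/-- Commutator of a word in the family `A` with a word in the family `B`.
If `[A_α, B_β] = Σ_γ Γ(α,β,γ) A_γ` with scalar coefficients, then for every
word `v` of length `n` in `A` and every word `w` of length `m ≥ 1` in `B`, the
commutator `[v, w]` lies in the `k`-submodule spanned by the elements
`v′ · w′` with `v′` a word in `A` of length exactly `n` and `w′` a word in `B`
of length at most `m − 1`. -/
theorem stmt12 {k R ι κ : Type*} [CommRing k] [Ring R] [Algebra k R]
    [Fintype ι] [Fintype κ] (A : ι → R) (B : κ → R)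
    (h : ∀ α : ι, ∀ β : κ, ∃ Γ : ι → k,
      A α * B β - B β * A α = ∑ γ : ι, Γ γ • A γ) :
    ∀ la : List ι, ∀ lb : List κ, 1 ≤ lb.length →
      (la.map A).prod * (lb.map B).prod - (lb.map B).prod * (la.map A).prod ∈
        Submodule.span k
          {x : R | ∃ la' : List ι, ∃ lb' : List κ,
            la'.length = la.length ∧ lb'.length < lb.length ∧
            x = (la'.map A).prod * (lb'.map B).prod} := by
  have h_letter : ∀ (β : κ) (la : List ι), (la.map A).prod * B β - B β * (la.map A).prod ∈
      Submodule.span k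
        {x : R | ∃ la' : List ι, la'.length = la.length ∧ x = (la'.map A).prod} := by
    refine fun β => word_commutator_mem_span A (B β) fun α => ?_
    obtain ⟨Γ, hΓ⟩ := h α β
    rw [hΓ]
    exact sum_mem fun γ _ => Submodule.smul_mem _ _ (Submodule.subset_span ⟨γ, rfl⟩)
  have h_mul : ∀ (β : κ) (la : List ι) (lb : List κ) (m : ℕ), lb.length < m →
      ((la.map A).prod * B β - B β * (la.map A).prod) * (lb.map B).prod ∈ Submodule.span k
        {x : R | ∃ la' : List ι, ∃ lb' : List κ, la'.length = la.length ∧ lb'.length < m ∧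
          x = (la'.map A).prod * (lb'.map B).prod} := by
    intro β la lb m hm
    refine (Submodule.span_le (p := (Submodule.span k _).comap
      (LinearMap.mulRight k (lb.map B).prod))).2 ?_ (h_letter β la)
    rintro _ ⟨la', hl, rfl⟩
    exact Submodule.subset_span ⟨la', lb, hl, hm, rfl⟩
  intro la lb _
  induction lb with
  | nil => simp
  | cons β lb ih =>
    have key : (la.map A).prod * ((β :: lb).map B).prod - ((β :: lb).map B).prod * (la.map A).prod =
        ((la.map A).prod * B β - B β * (la.map A).prod) * (lb.map B).prod +
          B β * ((la.map A).prod * (lb.map B).prod - (lb.map B).prod * (la.map A).prod) := by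
      simp only [List.map_cons, List.prod_cons]
      noncomm_ring
    rw [key]
    refine add_mem (h_mul β la lb _ (by simp)) ?_
    rcases lb.eq_nil_or_concat with rfl | ⟨_, _, hlb⟩
    · simp
    refine (Submodule.span_le (p := (Submodule.span k _).comap (LinearMap.mulLeft k (B β)))).2
      ?_ (ih (by simp [hlb]))
    rintro _ ⟨la', lb', hl, hlt, rfl⟩
    have hswap : B β * ((la'.map A).prod * (lb'.map B).prod) =
        (la'.map A).prod * ((β :: lb').map B).prod -
          ((la'.map A).prod * B β - B β * (la'.map A).prod) * (lb'.map B).prod := by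
      simp only [List.map_cons, List.prod_cons]
      noncomm_ring
    simp only [Submodule.comap_coe, Set.mem_preimage, LinearMap.mulLeft_apply, SetLike.mem_coe]
    rw [hswap]
    refine sub_mem (Submodule.subset_span ⟨la', β :: lb', hl, by simpa using hlt, rfl⟩) ?_
    rw [← hl]
    exact h_mul β la' lb' _ (by simp; omega)
end

section
/- Let R be an associative algebra over a commutative ring k, let A : ι → R, B : κ → R, C : μ → R be families indexed by finite types, and let H ⊆ R be a k-subalgebra such that: (i) [B_β, h] ∈ H and [C_ν, h] ∈ H for all h ∈ H, β ∈ κ, ν ∈ μ; (ii) for all α ∈ ι and β ∈ κ there exist h ∈ H with [A_α, B_β] = Σ_γ h(α,β,γ) A_γ, and similarly for all α ∈ ι and ν ∈ μ there exist h ∈ H with [A_α, C_ν] = Σ_γ h(α,ν,γ) A_γ. Then for every α ∈ ι, every word w_B of length m in B, and every word w_C of length p in C with m + p ≥ 1, the commutator [A_α, w_B · w_C] lies in the additive span of the elements h · A_γ · w_B′ · w_C′, where h ∈ H, γ ∈ ι, w_B′ is a word in B of length ≤ m, w_C′ is a word in C of length ≤ p, and (length of w_B′) + (length of w_C′) ≤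 m + p − 1. -/
/-- The additive span of the products `h * (A γ * w)` with `h ∈ H` and `w ∈ W`. -/
def coeffSpan {k R ι : Type*} [CommRing k] [Ring R] [Algebra k R]
    (A : ι → R) (H : Subalgebra k R) (W : Set R) : AddSubgroup R :=
  AddSubgroup.closure {x : R | ∃ h ∈ H, ∃ γ : ι, ∃ w ∈ W, x = h * (A γ * w)}

/-- The products `w_B · w_C` of words of length at most `m` and `p` respectively, and of total
length less than `m + p`. -/
def shorterWords {R κ μ : Type*} [Ring R] (B : κ → R) (C : μ → R) (m p : ℕ) : Set R :=
  {w : R | ∃ lb : List κ, ∃ lc : List μ, lb.length ≤ m ∧ lc.length ≤ p ∧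
    lb.length + lc.length < m + p ∧ w = (lb.map B).prod * (lc.map C).prod}

section CoeffSpan

variable {k R ι : Type*} [CommRing k] [Ring R] [Algebra k R]
  {A : ι → R} {H : Subalgebra k R}

theorem mul_mem_coeffSpan {W : Set R} {h w : R} (hh : h ∈ H) (γ : ι) (hw : w ∈ W) :
    h * (A γ * w) ∈ coeffSpan A H W :=
  AddSubgroup.subset_closure ⟨h, hh, γ, w, hw, rfl⟩

theorem mul_sum_mul_mem_coeffSpan [Fintype ι] {W : Set R} {h w : R} (hh : h ∈ H) {Γ : ι → R}
    (hΓ : ∀ γ, Γ γ ∈ H) (hw : w ∈ W) :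
    h * ((∑ γ, Γ γ * A γ) * w) ∈ coeffSpan A H W := by
  rw [Finset.sum_mul, Finset.mul_sum]
  refine sum_mem fun γ _ => ?_
  simpa only [mul_assoc] using mul_mem_coeffSpan (A := A) (H.mul_mem hh (hΓ γ)) γ hw

/-- Left multiplication by an element commuting with `H` and `A` up to lower-order terms maps
the span over `W` into the span over any set containing `W` and `b * W`. -/
theorem left_mul_mem_coeffSpan [Fintype ι] {W W' : Set R} {b x : R}
    (hstable : ∀ h ∈ H, b * h - h * b ∈ H)
    (hcomm : ∀ α : ι, ∃ Γ : ι → R, (∀ γ : ι, Γ γ ∈ H) ∧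
      A α * b - b * A α = ∑ γ : ι, Γ γ * A γ)
    (hsub : W ⊆ W') (hmul : ∀ w ∈ W, b * w ∈ W') (hx : x ∈ coeffSpan A H W) :
    b * x ∈ coeffSpan A H W' := by
  induction hx using AddSubgroup.closure_induction with
  | mem x hx =>
    obtain ⟨h, hh, γ, w, hw, rfl⟩ := hx
    obtain ⟨Γ, hΓ, hΓ_eq⟩ := hcomm γ
    have expand : b * (h * (A γ * w)) = (b * h - h * b) * (A γ * w) + h * (A γ * (b * w))
        - h * ((A γ * b - b * A γ) * w) := by noncomm_ring
    rw [expand, hΓ_eq]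
    exact sub_mem
      (add_mem (mul_mem_coeffSpan (hstable h hh) γ (hsub hw))
        (mul_mem_coeffSpan hh γ (hmul w hw)))
      (mul_sum_mul_mem_coeffSpan hh hΓ (hsub hw))
  | zero => simp
  | add x y _ _ hx hy => rw [mul_add]; exact add_mem hx hy
  | neg x _ hx => rw [mul_neg]; exact neg_mem hx

theorem commutator_mul_mem_coeffSpan [Fintype ι] {W W' : Set R} {b w : R} {α : ι}
    (hstable : ∀ h ∈ H, b * h - h * b ∈ H)
    (hcomm : ∀ α : ι, ∃ Γ : ι → R, (∀ γ : ι, Γ γ ∈ H) ∧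
      A α * b - b * A α = ∑ γ : ι, Γ γ * A γ)
    (hsub : W ⊆ W') (hmul : ∀ w ∈ W, b * w ∈ W') (hw : w ∈ W')
    (hx : A α * w - w * A α ∈ coeffSpan A H W) :
    A α * (b * w) - b * w * A α ∈ coeffSpan A H W' := by
  obtain ⟨Γ, hΓ, hΓ_eq⟩ := hcomm α
  have leibniz : A α * (b * w) - b * w * A α
      = 1 * ((A α * b - b * A α) * w) + b * (A α * w - w * A α) := by noncomm_ring
  rw [leibniz, hΓ_eq]
  exact add_mem (mul_sum_mul_mem_coeffSpan H.one_mem hΓ hw)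
    (left_mul_mem_coeffSpan hstable hcomm hsub hmul hx)

end CoeffSpan

section ShorterWords

variable {R κ μ : Type*} [Ring R] {B : κ → R} {C : μ → R}

theorem shorterWords_mono {m n p q : ℕ} (hmn : m ≤ n) (hpq : p ≤ q) :
    shorterWords B C m p ⊆ shorterWords B C n q := by
  rintro _ ⟨lb, lc, hb, hc, hbc, rfl⟩
  exact ⟨lb, lc, by omega, by omega, by omega, rfl⟩

theorem mul_mem_shorterWords_succ_left {m p : ℕ} (β : κ) {w : R}
    (hw : w ∈ shorterWords B C m p) : B β * w ∈ shorterWords B C (m + 1) p := by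
  obtain ⟨lb, lc, hb, hc, hbc, rfl⟩ := hw
  exact ⟨β :: lb, lc, by simpa using hb, hc, by simp only [List.length_cons]; omega,
    by simp [mul_assoc]⟩

theorem mul_mem_shorterWords_zero_succ {p : ℕ} (ν : μ) {w : R}
    (hw : w ∈ shorterWords B C 0 p) : C ν * w ∈ shorterWords B C 0 (p + 1) := by
  obtain ⟨lb, lc, hb, hc, hbc, rfl⟩ := hw
  obtain rfl : lb = [] := List.length_eq_zero_iff.mp (Nat.le_zero.mp hb)
  exact ⟨[], ν :: lc, by simp, by simpa using hc, by simpa using hbc, by simp⟩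

end ShorterWords


/-- Commutator of one element of the family `A` with a mixed word
`w_B · w_C` in the families `B` and `C`, with coefficients in a subalgebra `H`
stable under commutation with `B` and `C`. The commutator `[A_α, w_B · w_C]`
lies in the additive span of the elements `h · A_γ · w_B′ · w_C′` with
`h ∈ H`, `|w_B′| ≤ |w_B|`, `|w_C′| ≤ |w_C|`, and
`|w_B′| + |w_C′| ≤ |w_B| + |w_C| − 1`. -/
theorem stmt14 {k R ι κ μ : Type*} [CommRing k] [Ring R] [Algebra k R]
    [Fintype ι] [Fintype κ] [Fintype μ]
    (A : ι → R) (B : κ → R) (C : μ → R) (H : Subalgebra k R)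
    (hstableB : ∀ h ∈ H, ∀ β : κ, B β * h - h * B β ∈ H)
    (hstableC : ∀ h ∈ H, ∀ ν : μ, C ν * h - h * C ν ∈ H)
    (hcommB : ∀ α : ι, ∀ β : κ, ∃ Γ : ι → R, (∀ γ : ι, Γ γ ∈ H) ∧
      A α * B β - B β * A α = ∑ γ : ι, Γ γ * A γ)
    (hcommC : ∀ α : ι, ∀ ν : μ, ∃ Γ : ι → R, (∀ γ : ι, Γ γ ∈ H) ∧
      A α * C ν - C ν * A α = ∑ γ : ι, Γ γ * A γ) :
    ∀ α : ι, ∀ lb : List κ, ∀ lc : List μ, 1 ≤ lb.length + lc.length →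
      A α * ((lb.map B).prod * (lc.map C).prod)
          - (lb.map B).prod * (lc.map C).prod * A α ∈
        AddSubgroup.closure
          {x : R | ∃ h ∈ H, ∃ γ : ι, ∃ lb' : List κ, ∃ lc' : List μ,
            lb'.length ≤ lb.length ∧ lc'.length ≤ lc.length ∧
            lb'.length + lc'.length < lb.length + lc.length ∧
            x = h * (A γ * ((lb'.map B).prod * (lc'.map C).prod))} := by
  rintro α lb lc -
  suffices hmem : A α * ((lb.map B).prod * (lc.map C).prod)
      - (lb.map B).prod * (lc.map C).prod * A α ∈
        coeffSpan A H (shorterWords B C lb.length lc.length) by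
    refine AddSubgroup.closure_mono ?_ hmem
    rintro _ ⟨h, hh, γ, _, ⟨lb', lc', hb, hc, hbc, rfl⟩, rfl⟩
    exact ⟨h, hh, γ, lb', lc', hb, hc, hbc, rfl⟩
  induction lb with
  | nil =>
    simp only [List.map_nil, List.prod_nil, one_mul, List.length_nil]
    induction lc with
    | nil => simp
    | cons ν lc ih =>
      rw [List.map_cons, List.prod_cons]
      exact commutator_mul_mem_coeffSpan (fun h hh => hstableC h hh ν) (fun α => hcommC α ν)
        (shorterWords_mono le_rfl (Nat.le_succ _)) (fun _ => mul_mem_shorterWords_zero_succ ν)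
        ⟨[], lc, by simp, by simp, by simp, by simp⟩ ih
  | cons β lb ih =>
    rw [List.map_cons, List.prod_cons, mul_assoc (B β)]
    exact commutator_mul_mem_coeffSpan (fun h hh => hstableB h hh β) (fun α => hcommB α β)
      (shorterWords_mono (Nat.le_succ _) le_rfl) (fun _ => mul_mem_shorterWords_succ_left β)
      ⟨lb, lc, by simp, le_rfl, by simp, rfl⟩ ih
end
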